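/- arXiv:1009.3531 — 2 statements merged into one kernel-verified Lean document; each statement's English description precedes it below -/
import Mathlib

section
/- Let R be a commutative Noetherian ring, 𝔞 an ideal, M a finitely generated R-module, and t, n₀ positive integers such that 𝔞^{n₀}·H^i_𝔞(M) = 0 for all i < t. Then for every 𝔞-filter regular sequence x₁, …, x_t of M contained in 𝔞^{2n₀} and every j with 1 ≤ j ≤ t, one has ⋃_{i=0}^{j} Ass(H^i_𝔞(M)) = Ass(M/(x₁,…,x_j)M) ∩ V(𝔞). -/
open CategoryTheory
universe u
namespace LCProof
open Opposite Limits
noncomputable section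

section Opp
variable {R : Type} [CommRing R]

def zI (L : ChainComplex (ModuleCat.{0} R)ᵒᵖ ℕ) (n : ℕ) :
    (L.opcycles n).unop →ₗ[R] (L.X n).unop := (L.pOpcycles n).unop.hom

def zQ (L : ChainComplex (ModuleCat.{0} R)ᵒᵖ ℕ) (n : ℕ) :
    (L.opcycles n).unop →ₗ[R] (L.homology n).unop := (L.homologyι n).unop.hom

variable (L : ChainComplex (ModuleCat.{0} R)ᵒᵖ ℕ) (n : ℕ)

lemma zI_inj : Function.Injective (zI L n) :=
  (ModuleCat.mono_iff_injective (L.pOpcycles n).unop).1 inferInstance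

lemma zQ_surj : Function.Surjective (zQ L n) :=
  (ModuleCat.epi_iff_surjective (L.homologyι n).unop).1 inferInstance

lemma zI_d (z) : (L.d (n+1) n).unop.hom (zI L n z) = 0 := by
  have h := congrArg Quiver.Hom.unop (L.d_pOpcycles (n+1) n)
  rw [unop_comp] at h
  exact LinearMap.congr_fun (congrArg ModuleCat.Hom.hom h) z

lemma zI_range (f : (L.X n).unop) (hf : (L.d (n+1) n).unop.hom f = 0) : ∃ z, zI L n z = f := by
  have hex : (ShortComplex.mk (L.d (n+1) n) (L.pOpcycles n) (L.d_pOpcycles _ _)).Exact := 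
    ShortComplex.exact_of_g_is_cokernel _ (L.opcyclesIsCokernel (n+1) n (by simp))
  have h2 := hex.unop
  rw [ShortComplex.moduleCat_exact_iff] at h2
  exact h2 f hf

lemma zQ_eq_zero_iff (z) (j : ℕ) (hj : (ComplexShape.down ℕ).next n = j) : zQ L n z = 0 ↔ 
     ∃ g : (L.X j).unop, (L.d n j).unop.hom g = zI L n z := by
  have hex : (ShortComplex.mk (L.homologyι n) (L.fromOpcycles n j) 
      (L.homologyι_comp_fromOpcycles _ _)).Exact := 
    ShortComplex.exact_of_f_is_kernel _ (L.homologyIsKernel n j hj)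
  have h2 := hex.unop
  rw [ShortComplex.moduleCat_exact_iff] at h2
  have hp : ∀ g : (L.X j).unop, (L.d n j).unop.hom g = zI L n ((L.fromOpcycles n j).unop.hom g) := by
    intro g
    have h := congrArg Quiver.Hom.unop (L.p_fromOpcycles n j)
    rw [unop_comp] at h
    exact (LinearMap.congr_fun (congrArg ModuleCat.Hom.hom h) g).symm
  constructor
  · intro h
    obtain ⟨g, hg⟩ := h2 z h
    refine ⟨g, ?_⟩
    exact (hp g).trans (congrArg _ hg)
  · rintro ⟨g, hg⟩
    rw [hp] at hg
    rw [← zI_inj L n hg]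
    have h := congrArg Quiver.Hom.unop (L.homologyι_comp_fromOpcycles n j)
    rw [unop_comp] at h
    exact (LinearMap.congr_fun (congrArg ModuleCat.Hom.hom h) g)

variable {L} in
lemma zI_nat {L' : ChainComplex (ModuleCat.{0} R)ᵒᵖ ℕ} (φ : L ⟶ L') (z) :
    zI L n ((HomologicalComplex.opcyclesMap φ n).unop.hom z) = (φ.f n).unop.hom (zI L' n z) := by
  have h := congrArg Quiver.Hom.unop (HomologicalComplex.p_opcyclesMap φ n)
  rw [unop_comp, unop_comp] at h
  exact (LinearMap.congr_fun (congrArg ModuleCat.Hom.hom h) z)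

variable {L} in
lemma zQ_nat {L' : ChainComplex (ModuleCat.{0} R)ᵒᵖ ℕ} (φ : L ⟶ L') (z) :
    zQ L n ((HomologicalComplex.opcyclesMap φ n).unop.hom z) = 
      (HomologicalComplex.homologyMap φ n).unop.hom (zQ L' n z) := by
  have h := congrArg Quiver.Hom.unop (HomologicalComplex.homologyι_naturality φ n)
  rw [unop_comp, unop_comp] at h
  exact (LinearMap.congr_fun (congrArg ModuleCat.Hom.hom h) z).symm
end Opp

section Bridge
variable {R : Type} [CommRing R] {X M : ModuleCat.{0} R} (P : ProjectiveResolution X)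
open Abelian

lemma extMk_zero_eq_zero (f : P.complex.X 0 ⟶ M) (hf : P.complex.d 1 0 ≫ f = 0)
  (h : P.extMk f 1 rfl hf = 0) : f = 0 := by
  simp only [← P.extEquivCohomologyClass.apply_eq_iff_eq,
    ProjectiveResolution.extEquivCohomologyClass_extMk, ProjectiveResolution.extEquivCohomologyClass_zero,
    CochainComplex.HomComplex.CohomologyClass.mk_eq_zero_iff] at h
  rw [CochainComplex.HomComplex.Cocycle.toSingleMk_mem_coboundaries_iff _ _ _ _ _ 1 (by lia)] at h
  obtain ⟨g, hg⟩ := h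
  have : IsZero (P.cochainComplex.X 1) := P.cochainComplex.isZero_of_isStrictlyLE 0 1
  rw [this.eq_of_src g 0, comp_zero] at hg
  rw [← cancel_epi (P.cochainComplexXIso (-(0:ℕ)) 0 rfl).hom]
  rw [← hg, comp_zero]

abbrev FP (P : ProjectiveResolution X) (M : ModuleCat.{0} R) : ChainComplex (ModuleCat.{0} R)ᵒᵖ ℕ :=
  (((linearYoneda R (ModuleCat.{0} R)).obj M).rightOp.mapHomologicalComplex _).obj P.complex

def toHom (n : ℕ) (f : ((FP P M).X n).unop) : P.complex.X n ⟶ M := f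

lemma toHom_add (n : ℕ) (f g : ((FP P M).X n).unop) : toHom P n (f + g) = toHom P n f + toHom P n g := rfl
lemma toHom_smul (n : ℕ) (r : R) (f : ((FP P M).X n).unop) : toHom P n (r • f) = r • toHom P n f := rfl
lemma toHom_d (m n : ℕ) (f : ((FP P M).X n).unop) : 
   toHom P m (((FP P M).d m n).unop.hom f) = P.complex.d m n ≫ toHom P n f := rfl

lemma smul_extMk (n : ℕ) (r : R) (f : P.complex.X n ⟶ M) (hf : P.complex.d (n+1) n ≫ f = 0) :
    r • P.extMk f (n+1) rfl hf = P.extMk (r • f) (n+1) rfl (by simp [hf]) := by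
  rw [Ext.smul_eq_comp_mk₀, ProjectiveResolution.extMk_comp_mk₀]
  congr 1

lemma zI_cocycle (n : ℕ) (z) : P.complex.d (n+1) n ≫ toHom P n (zI (FP P M) n z) = 0 := by
  rw [← toHom_d, zI_d]; rfl

def zE (n : ℕ) : ((FP P M).opcycles n).unop →ₗ[R] Ext X M n where
  toFun z := P.extMk (toHom P n (zI _ n z)) (n+1) rfl (zI_cocycle P n z)
  map_add' z w := by
    rw [ProjectiveResolution.add_extMk]
    congr 1
    rw [map_add, toHom_add]
  map_smul' r z := by
    rw [RingHom.id_apply, smul_extMk]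
    congr 1
    rw [map_smul, toHom_smul]

lemma zE_apply (n : ℕ) (z) : zE (M := M) P n z = 
  P.extMk (toHom P n (zI _ n z)) (n+1) rfl (zI_cocycle P n z) := rfl

lemma zE_surj (n : ℕ) : Function.Surjective (zE (M := M) P n) := by
  intro α
  obtain ⟨f, hf, rfl⟩ := P.extMk_surjective α (n+1) rfl
  obtain ⟨z, hz⟩ := zI_range (FP P M) n f (hf)
  refine ⟨z, ?_⟩
  rw [zE_apply]
  congr 1

lemma zE_eq_zero_iff (n : ℕ) (z) : zE (M := M) P n z = 0 ↔ zQ (FP P M) n z = 0 := by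
  cases n with
  | zero =>
    rw [zQ_eq_zero_iff _ _ _ 0 (by simp)]
    constructor
    · intro h
      have := extMk_zero_eq_zero P _ (zI_cocycle P 0 z) h
      refine ⟨0, ?_⟩
      rw [map_zero]; exact this.symm
    · rintro ⟨g, hg⟩
      have : toHom P 0 (zI _ 0 z) = 0 := by
        rw [← hg, toHom_d, P.complex.shape _ _ (by simp), zero_comp]
      rw [zE_apply]
      simp only [this, ProjectiveResolution.extMk_zero]
  | succ n =>
    rw [zQ_eq_zero_iff _ _ _ n (by simp)]
    rw [zE_apply]
    rw [P.extMk_eq_zero_iff _ _ _ _ n rfl]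
    rfl

/-- old Ext -/
abbrev OE (n : ℕ) (X M : ModuleCat.{0} R) : ModuleCat.{0} R :=
  ((Ext R (ModuleCat.{0} R) n).obj (op X)).obj M

def oQ (n : ℕ) : ((FP P M).opcycles n).unop →ₗ[R] OE n X M :=
  (P.isoLeftDerivedObj ((linearYoneda R (ModuleCat.{0} R)).obj M).rightOp n).hom.unop.hom ∘ₗ zQ (FP P M) n

lemma oQ_surj (n : ℕ) : Function.Surjective (oQ (M := M) P n) := by
  have := (ModuleCat.epi_iff_surjective (P.isoLeftDerivedObj ((linearYoneda R (ModuleCat.{0} R)).obj M).rightOp n).hom.unop).1 inferInstance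
  intro y
  obtain ⟨y', rfl⟩ := this y
  obtain ⟨y, rfl⟩ := zQ_surj (FP P M) n y'
  exact ⟨y, rfl⟩

lemma oQ_ker (n : ℕ) : LinearMap.ker (oQ (M := M) P n) = LinearMap.ker (zE (M := M) P n) := by
  ext z
  rw [LinearMap.mem_ker, LinearMap.mem_ker, zE_eq_zero_iff]
  have := (ModuleCat.mono_iff_injective (P.isoLeftDerivedObj ((linearYoneda R (ModuleCat.{0} R)).obj M).rightOp n).hom.unop).1 inferInstance
  exact map_eq_zero_iff (P.isoLeftDerivedObj ((linearYoneda R (ModuleCat.{0} R)).obj M).rightOp n).hom.unop.hom this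

def bridgeP (n : ℕ) : OE n X M ≃ₗ[R] Ext X M n :=
  ((oQ (M := M) P n).quotKerEquivOfSurjective (oQ_surj P n)).symm ≪≫ₗ
    Submodule.quotEquivOfEq _ _ (oQ_ker P n) ≪≫ₗ 
     ((zE (M := M) P n).quotKerEquivOfSurjective (zE_surj P n))

lemma bridgeP_oQ (n : ℕ) (z) : bridgeP P n (oQ (M := M) P n z) = zE P n z := by
  have : ((oQ (M := M) P n).quotKerEquivOfSurjective (oQ_surj P n)).symm (oQ (M := M) P n z) = 
    Submodule.Quotient.mk z := by
    rw [LinearEquiv.symm_apply_eq]; rfl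
  simp only [bridgeP, LinearEquiv.trans_apply, this]
  rfl

lemma bridgeP_nat (n : ℕ) {X' : ModuleCat.{0} R} (P' : ProjectiveResolution X') (g : X' ⟶ X) 
    (α : OE n X M) : 
    bridgeP P' n ((((Ext R (ModuleCat.{0} R) n).map g.op).app M).hom α) =
      (Ext.mk₀ g).comp (bridgeP P n α) (zero_add n) := by
  obtain ⟨z, rfl⟩ := oQ_surj P n α
  rw [bridgeP_oQ]
  let φ := ProjectiveResolution.lift g P' P
  let ψ : ProjectiveResolution.Hom P' P g := ⟨φ, ProjectiveResolution.lift_commutes_zero g P' P⟩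
  rw [zE_apply]
  rw [ProjectiveResolution.mk₀_comp_extMk _ _ _ _ ψ]
  let F := ((linearYoneda R (ModuleCat.{0} R)).obj M).rightOp
  let Φ : FP P' M ⟶ FP P M := (F.mapHomologicalComplex _).map φ
  have key : (((Ext R (ModuleCat.{0} R) n).map g.op).app M).hom (oQ P n z) = 
     oQ P' n ((HomologicalComplex.opcyclesMap Φ n).unop.hom z) := by
    have h := congrArg Quiver.Hom.unop 
      (ProjectiveResolution.isoLeftDerivedObj_hom_naturality g P' P φ (ProjectiveResolution.lift_commutes_zero g P' P) F n)
    rw [unop_comp, unop_comp] at h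
    have h2 := (LinearMap.congr_fun (congrArg ModuleCat.Hom.hom h) (zQ (FP P M) n z))
    refine h2.trans ?_
    exact (congrArg (P'.isoLeftDerivedObj F n).hom.unop.hom (zQ_nat n Φ z)).symm
  rw [key, bridgeP_oQ]
  rw [zE_apply]
  congr 1
  rw [zI_nat]
  rfl

def bridge (n : ℕ) (X M : ModuleCat.{0} R) : OE n X M ≃ₗ[R] Ext X M n :=
  bridgeP (projectiveResolution X) n

lemma bridge_nat (n : ℕ) {X X' : ModuleCat.{0} R} (g : X' ⟶ X) 
    (α : OE n X M) : 
    bridge n X' M ((((Ext R (ModuleCat.{0} R) n).map g.op).app M).hom α) =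
      (Ext.mk₀ g).comp (bridge n X M α) (zero_add n) := bridgeP_nat _ _ _ _ _
end Bridge

section LC
open Abelian
variable {R : Type} [CommRing R] (𝔞 : Ideal R)

abbrev Q (n : ℕ) : ModuleCat.{0} R := ModuleCat.of R (R ⧸ 𝔞 ^ n)

def tr {n m : ℕ} (h : n ≤ m) : Q 𝔞 m ⟶ Q 𝔞 n :=
  ModuleCat.ofHom (Submodule.mapQ _ _ LinearMap.id (Ideal.pow_le_pow_right h))

lemma tr_refl (n : ℕ) : tr 𝔞 (le_refl n) = 𝟙 _ := by
  ext; rfl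

lemma tr_trans {n m k : ℕ} (h : n ≤ m) (h' : m ≤ k) : tr 𝔞 h' ≫ tr 𝔞 h = tr 𝔞 (h.trans h') := by
  ext; rfl

abbrev G (M : ModuleCat.{0} R) (i n : ℕ) : Type := Ext (Q 𝔞 n) M i

def trG (M : ModuleCat.{0} R) (i n m : ℕ) (h : n ≤ m) : G 𝔞 M i n →ₗ[R] G 𝔞 M i m where
  toFun α := (Ext.mk₀ (tr 𝔞 h)).comp α (zero_add i)
  map_add' _ _ := Ext.comp_add _ _ _ _
  map_smul' _ _ := Ext.comp_smul _ _ _ _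

instance (M : ModuleCat.{0} R) (i : ℕ) : DirectedSystem (G 𝔞 M i) (trG 𝔞 M i · · ·) where
  map_self n x := by
    change (Ext.mk₀ (tr 𝔞 _)).comp _ (zero_add i) = x
    rw [tr_refl, Ext.mk₀_id_comp]
  map_map _ _ _ h h' x := by
    change (Ext.mk₀ (tr 𝔞 _)).comp ((Ext.mk₀ (tr 𝔞 _)).comp x (zero_add i)) (zero_add i) = 
      (Ext.mk₀ (tr 𝔞 _)).comp x (zero_add i)
    rw [Ext.mk₀_comp_mk₀_assoc, tr_trans]

abbrev LC (M : ModuleCat.{0} R) (i : ℕ) : Type := Module.DirectLimit (G 𝔞 M i) (trG 𝔞 M i)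

abbrev lof (M : ModuleCat.{0} R) (i n : ℕ) : G 𝔞 M i n →ₗ[R] LC 𝔞 M i := 
  Module.DirectLimit.of R ℕ (G 𝔞 M i) (trG 𝔞 M i) n

def OD (M : ModuleCat.{0} R) (i : ℕ) : (ℕᵒᵖ)ᵒᵖ ⥤ ModuleCat.{0} R :=
  localCohomology.diagram (localCohomology.idealPowersDiagram 𝔞) i ⋙ (evaluation _ _).obj M

def OC (M : ModuleCat.{0} R) (i : ℕ) : Cocone (OD 𝔞 M i) :=
  ((evaluation _ _).obj M).mapCocone 
    (colimit.cocone (localCohomology.diagram (localCohomology.idealPowersDiagram 𝔞) i))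

def OCcolim (M : ModuleCat.{0} R) (i : ℕ) : IsColimit (OC 𝔞 M i) :=
  isColimitOfPreserves _ (colimit.isColimit _)

def toLCCocone (M : ModuleCat.{0} R) (i : ℕ) : Cocone (OD 𝔞 M i) where
  pt := ModuleCat.of R (LC 𝔞 M i)
  ι := { app := fun n => ModuleCat.ofHom 
          (lof 𝔞 M i n.unop.unop ∘ₗ (bridge i (Q 𝔞 n.unop.unop) M).toLinearMap)
         naturality := by
          intro n m f
          ext x
          have h : n.unop.unop ≤ m.unop.unop := f.unop.unop.down.down
          have h1 := bridge_nat (M := M) i (tr 𝔞 h) x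
          exact (congrArg (lof 𝔞 M i m.unop.unop) h1).trans 
            (Module.DirectLimit.of_f (f := trG 𝔞 M i) (hij := h)) }

def toLC (M : ModuleCat.{0} R) (i : ℕ) : ((localCohomology 𝔞 i).obj M) →ₗ[R] LC 𝔞 M i :=
  ((OCcolim 𝔞 M i).desc (toLCCocone 𝔞 M i)).hom

def oι (M : ModuleCat.{0} R) (i n : ℕ) : OE i (Q 𝔞 n) M →ₗ[R] ((localCohomology 𝔞 i).obj M) :=
  ((OC 𝔞 M i).ι.app (op (op n))).hom

lemma oι_map (M : ModuleCat.{0} R) (i n m : ℕ) (h : n ≤ m) (x) :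
    oι 𝔞 M i m ((((Ext R (ModuleCat.{0} R) i).map (tr 𝔞 h).op).app M).hom x) = oι 𝔞 M i n x := by
  have := (OC 𝔞 M i).w (homOfLE h).op.op
  exact LinearMap.congr_fun (congrArg ModuleCat.Hom.hom this) x

lemma toLC_oι (M : ModuleCat.{0} R) (i n : ℕ) (x) : 
    toLC 𝔞 M i (oι 𝔞 M i n x) = lof 𝔞 M i n (bridge i _ M x) := 
  LinearMap.congr_fun (congrArg ModuleCat.Hom.hom 
    ((OCcolim 𝔞 M i).fac (toLCCocone 𝔞 M i) (op (op n)))) x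

def ofLC (M : ModuleCat.{0} R) (i : ℕ) : LC 𝔞 M i →ₗ[R] ((localCohomology 𝔞 i).obj M) :=
  Module.DirectLimit.lift R ℕ (G 𝔞 M i) (trG 𝔞 M i) 
    (fun n => oι 𝔞 M i n ∘ₗ (bridge i (Q 𝔞 n) M).symm.toLinearMap) (by
      intro n m h x
      obtain ⟨y, rfl⟩ := (bridge i (Q 𝔞 n) M).surjective x
      have h1 := bridge_nat (M := M) i (tr 𝔞 h) y
      change oι 𝔞 M i m ((bridge i (Q 𝔞 m) M).symm ((Ext.mk₀ (tr 𝔞 _)).comp (bridge i (Q 𝔞 n) M y) (zero_add i))) = 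
        oι 𝔞 M i n ((bridge i (Q 𝔞 n) M).symm (bridge i (Q 𝔞 n) M y))
      rw [← h1, LinearEquiv.symm_apply_apply, LinearEquiv.symm_apply_apply, oι_map])

def equivLC (M : ModuleCat.{0} R) (i : ℕ) : ((localCohomology 𝔞 i).obj M) ≃ₗ[R] LC 𝔞 M i :=
  LinearEquiv.ofLinearMap (toLC 𝔞 M i) (ofLC 𝔞 M i) 
    (by
      ext n x
      change toLC 𝔞 M i (ofLC 𝔞 M i (lof 𝔞 M i n x)) = lof 𝔞 M i n x
      rw [ofLC, Module.DirectLimit.lift_of]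
      refine (toLC_oι _ _ _ _ _).trans ?_
      exact congrArg _ (LinearEquiv.apply_symm_apply _ _))
    (by
      have : ModuleCat.ofHom (ofLC 𝔞 M i ∘ₗ toLC 𝔞 M i) = 𝟙 ((localCohomology 𝔞 i).obj M) := by
        refine (OCcolim 𝔞 M i).hom_ext ?_
        intro n
        ext x
        have key : ∀ (n : ℕ) (x), ofLC 𝔞 M i (toLC 𝔞 M i (oι 𝔞 M i n x)) = oι 𝔞 M i n x := by
          intro n x
          rw [toLC_oι, ofLC, Module.DirectLimit.lift_of]
          exact congrArg _ (LinearEquiv.symm_apply_apply _ _)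
        exact key n.unop.unop x
      exact congrArg ModuleCat.Hom.hom this)
end LC
end
end LCProof

open CategoryTheory
namespace LCProof
open Opposite Limits
noncomputable section
section LC2
open Abelian
variable {R : Type} [CommRing R] (𝔞 : Ideal R)

lemma lof_exists {M : ModuleCat.{0} R} {i : ℕ} (ξ : LC 𝔞 M i) :
    ∃ n, ∃ α : Ext (Q 𝔞 n) M i, lof 𝔞 M i n α = ξ := Module.DirectLimit.exists_of ξ

lemma lof_eq_zero {M : ModuleCat.{0} R} {i n : ℕ} (α : Ext (Q 𝔞 n) M i) (h : lof 𝔞 M i n α = 0) :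
    ∃ m, ∃ hm : n ≤ m, (Ext.mk₀ (tr 𝔞 hm)).comp α (zero_add i) = 0 :=
  Module.DirectLimit.of.zero_exact h

lemma lof_tr {M : ModuleCat.{0} R} {i n m : ℕ} (h : n ≤ m) (α : Ext (Q 𝔞 n) M i) :
    lof 𝔞 M i m ((Ext.mk₀ (tr 𝔞 h)).comp α (zero_add i)) = lof 𝔞 M i n α :=
  Module.DirectLimit.of_f (f := trG 𝔞 M i) (hij := h)

def post {M N : ModuleCat.{0} R} {e i k : ℕ} (α : Ext M N e) (h : i + e = k) :
    LC 𝔞 M i →ₗ[R] LC 𝔞 N k :=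
  Module.DirectLimit.map 
    (fun n => { toFun := fun β => β.comp α h
                map_add' := fun _ _ => Ext.add_comp _ _ _ _
                map_smul' := fun _ _ => Ext.smul_comp _ _ _ _ }) (by
      intro n m hnm
      ext β
      change ((Ext.mk₀ (tr 𝔞 hnm)).comp β (zero_add i)).comp α h = (Ext.mk₀ (tr 𝔞 hnm)).comp (β.comp α h) (zero_add k)
      rw [Ext.comp_assoc]; omega)

@[simp]
lemma post_lof {M N : ModuleCat.{0} R} {e i k n : ℕ} (α : Ext M N e) (h : i + e = k) 
    (β : Ext (Q 𝔞 n) M i) : post 𝔞 α h (lof 𝔞 M i n β) = lof 𝔞 N k n (β.comp α h) :=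
  Module.DirectLimit.map_apply_of _ _ _

lemma post_post {M N K : ModuleCat.{0} R} {e e' e'' i k l : ℕ} (α : Ext M N e) (α' : Ext N K e') 
    (h : i + e = k) (h' : k + e' = l) (h'' : e + e' = e'') (ξ : LC 𝔞 M i) :
    post 𝔞 α' h' (post 𝔞 α h ξ) = post 𝔞 (α.comp α' h'') (by omega) ξ := by
  obtain ⟨n, β, rfl⟩ := lof_exists 𝔞 ξ
  simp only [post_lof]
  rw [Ext.comp_assoc]; omega

lemma post_add {M N : ModuleCat.{0} R} {e i k : ℕ} (α α' : Ext M N e) (h : i + e = k) :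
    post 𝔞 (α + α') h = post 𝔞 α h + post 𝔞 α' h := by
  ext n β
  change post 𝔞 _ h (lof _ _ _ _ _) = post 𝔞 _ h (lof _ _ _ _ _) + post 𝔞 _ h (lof _ _ _ _ _)
  simp only [post_lof]
  rw [Ext.comp_add, map_add]

lemma post_smul {M N : ModuleCat.{0} R} {e i k : ℕ} (r : R) (α : Ext M N e) (h : i + e = k) :
    post 𝔞 (r • α) h = r • post 𝔞 α h := by
  ext n β
  change post 𝔞 _ h (lof _ _ _ _ _) = r • post 𝔞 _ h (lof _ _ _ _ _)
  simp only [post_lof]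
  rw [Ext.comp_smul, map_smul]

lemma post_zero {M N : ModuleCat.{0} R} {e i k : ℕ} (h : i + e = k) (ξ) :
    post 𝔞 (0 : Ext M N e) h ξ = 0 := by
  have := post_smul 𝔞 0 (0 : Ext M N e) h
  simp only [zero_smul] at this
  rw [this]; rfl

def pm {M N : ModuleCat.{0} R} (f : M ⟶ N) (i : ℕ) : LC 𝔞 M i →ₗ[R] LC 𝔞 N i :=
  post 𝔞 (Ext.mk₀ f) (add_zero i)

lemma pm_comp {M N K : ModuleCat.{0} R} (f : M ⟶ N) (g : N ⟶ K) (i : ℕ) (ξ) :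
    pm 𝔞 (f ≫ g) i ξ = pm 𝔞 g i (pm 𝔞 f i ξ) := by
  rw [pm, pm, pm, post_post 𝔞 _ _ _ _ (zero_add 0), Ext.mk₀_comp_mk₀]

lemma pm_id (M : ModuleCat.{0} R) (i : ℕ) (ξ) : pm 𝔞 (𝟙 M) i ξ = ξ := by
  obtain ⟨n, β, rfl⟩ := lof_exists 𝔞 ξ
  rw [pm, post_lof, Ext.comp_mk₀_id]

lemma pm_smul {M N : ModuleCat.{0} R} (r : R) (f : M ⟶ N) (i : ℕ) (ξ) : 
    pm 𝔞 (r • f) i ξ = r • pm 𝔞 f i ξ := by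
  rw [pm, Ext.mk₀_smul, post_smul]; rfl

lemma pm_add {M N : ModuleCat.{0} R} (f g : M ⟶ N) (i : ℕ) (ξ) : 
    pm 𝔞 (f + g) i ξ = pm 𝔞 f i ξ + pm 𝔞 g i ξ := by
  rw [pm, Ext.mk₀_add, post_add]; rfl

lemma pm_zero {M N : ModuleCat.{0} R} (i : ℕ) (ξ) : pm 𝔞 (0 : M ⟶ N) i ξ = 0 := by
  rw [pm, Ext.mk₀_zero, post_zero]

lemma pm_sum {M N : ModuleCat.{0} R} {ι : Type} (s : Finset ι) (f : ι → (M ⟶ N)) (i : ℕ) (ξ) : 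
    pm 𝔞 (∑ k ∈ s, f k) i ξ = ∑ k ∈ s, pm 𝔞 (f k) i ξ := by
  classical
  induction s using Finset.induction_on with
  | empty => simp [pm_zero]
  | insert a s ha ih => rw [Finset.sum_insert ha, Finset.sum_insert ha, pm_add, ih]

variable {S : ShortComplex (ModuleCat.{0} R)} (hS : S.ShortExact)

def dl (i : ℕ) : LC 𝔞 S.X₃ i →ₗ[R] LC 𝔞 S.X₁ (i+1) := post 𝔞 hS.extClass rfl

lemma lc_exact₂ (hS : S.ShortExact) (i : ℕ) (ξ : LC 𝔞 S.X₂ i) (h : pm 𝔞 S.g i ξ = 0) : ∃ η, pm 𝔞 S.f i η = ξ := by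
  obtain ⟨n, β, rfl⟩ := lof_exists 𝔞 ξ
  rw [pm, post_lof] at h
  obtain ⟨m, hm, h⟩ := lof_eq_zero 𝔞 _ h
  rw [← Ext.comp_assoc (h₁₂ := zero_add i) (h := by omega)] at h
  obtain ⟨γ, hγ⟩ := Ext.covariant_sequence_exact₂ _ hS _ h
  refine ⟨lof 𝔞 _ _ _ γ, ?_⟩
  rw [pm, post_lof, hγ, lof_tr]

lemma lc_exact₁ (i : ℕ) (ξ : LC 𝔞 S.X₁ (i+1)) (h : pm 𝔞 S.f (i+1) ξ = 0) : ∃ η, dl 𝔞 hS i η = ξ := by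
  obtain ⟨n, β, rfl⟩ := lof_exists 𝔞 ξ
  rw [pm, post_lof] at h
  obtain ⟨m, hm, h⟩ := lof_eq_zero 𝔞 _ h
  rw [← Ext.comp_assoc (h₁₂ := zero_add _) (h := by omega)] at h
  obtain ⟨γ, hγ⟩ := Ext.covariant_sequence_exact₁ _ hS _ h rfl
  refine ⟨lof 𝔞 _ _ _ γ, ?_⟩
  rw [dl, post_lof, hγ, lof_tr]

lemma lc_exact₃ (i : ℕ) (ξ : LC 𝔞 S.X₃ i) (h : dl 𝔞 hS i ξ = 0) : ∃ η, pm 𝔞 S.g i η = ξ := by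
  obtain ⟨n, β, rfl⟩ := lof_exists 𝔞 ξ
  rw [dl, post_lof] at h
  obtain ⟨m, hm, h⟩ := lof_eq_zero 𝔞 _ h
  rw [← Ext.comp_assoc (h₁₂ := zero_add _) (h := by omega)] at h
  obtain ⟨γ, hγ⟩ := Ext.covariant_sequence_exact₃ _ hS _ rfl h
  refine ⟨lof 𝔞 _ _ _ γ, ?_⟩
  rw [pm, post_lof, hγ, lof_tr]

lemma dl_pm (i : ℕ) (ξ) : dl 𝔞 hS i (pm 𝔞 S.g i ξ) = 0 := by
  rw [dl, pm, post_post 𝔞 _ _ _ _ (zero_add 1), hS.comp_extClass, post_zero]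

lemma pm_dl (i : ℕ) (ξ) : pm 𝔞 S.f (i+1) (dl 𝔞 hS i ξ) = 0 := by
  rw [dl, pm, post_post 𝔞 _ _ _ _ (add_zero 1), hS.extClass_comp, post_zero]

lemma dl_nat {S' : ShortComplex (ModuleCat.{0} R)} (hS' : S'.ShortExact) (φ : S ⟶ S') (i : ℕ) (ξ) :
    dl 𝔞 hS' i (pm 𝔞 φ.τ₃ i ξ) = pm 𝔞 φ.τ₁ (i+1) (dl 𝔞 hS i ξ) := by
  rw [dl, dl, pm, pm, post_post 𝔞 _ _ _ _ (zero_add 1), post_post 𝔞 _ _ _ _ (add_zero 1), 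
    ShortComplex.ShortExact.extClass_naturality]

lemma lc_torsion {M : ModuleCat.{0} R} {i : ℕ} (ξ : LC 𝔞 M i) : ∃ n, ∀ r ∈ 𝔞 ^ n, r • ξ = 0 := by
  obtain ⟨n, β, rfl⟩ := lof_exists 𝔞 ξ
  refine ⟨n, fun r hr => ?_⟩
  rw [← map_smul]
  have : r • β = 0 := by
    rw [← Ext.mk₀_id_comp β, ← Ext.smul_comp, ← Ext.mk₀_smul]
    have : r • 𝟙 (Q 𝔞 n) = 0 := by
      ext
      change r • (Submodule.Quotient.mk 1 : R ⧸ 𝔞 ^ n) = 0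
      rw [← Submodule.Quotient.mk_smul, Submodule.Quotient.mk_eq_zero]
      simpa using hr
    rw [this, Ext.mk₀_zero, Ext.zero_comp]
  rw [this, map_zero]

def q1 (n : ℕ) : Q 𝔞 n := (Submodule.Quotient.mk 1 : R ⧸ 𝔞 ^ n)

lemma q1_smul (n : ℕ) (r : R) (hr : r ∈ 𝔞 ^ n) : r • q1 𝔞 n = 0 := by
  change r • (Submodule.Quotient.mk 1 : R ⧸ 𝔞 ^ n) = 0
  rw [← Submodule.Quotient.mk_smul, Submodule.Quotient.mk_eq_zero]
  simpa using hr

lemma qhom_ext {n : ℕ} {N : ModuleCat.{0} R} (u v : Q 𝔞 n ⟶ N) (h : u.hom (q1 𝔞 n) = v.hom (q1 𝔞 n)) :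
    u = v := by
  ext
  exact h

lemma lof0_eq_zero_iff {n : ℕ} {N : ModuleCat.{0} R} (u : Q 𝔞 n ⟶ N) : 
    lof 𝔞 N 0 n (Ext.mk₀ u) = 0 ↔ u.hom (q1 𝔞 n) = 0 := by
  constructor
  · intro h
    obtain ⟨m, hm, h⟩ := lof_eq_zero 𝔞 _ h
    rw [Ext.mk₀_comp_mk₀, Ext.mk₀_eq_zero_iff] at h
    exact LinearMap.congr_fun (congrArg ModuleCat.Hom.hom h) (q1 𝔞 m)
  · intro h
    have : u = 0 := qhom_ext 𝔞 _ _ (by simpa using h)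
    rw [this, Ext.mk₀_zero, map_zero]

lemma lof0_exists {N : ModuleCat.{0} R} (ξ : LC 𝔞 N 0) : 
    ∃ n, ∃ u : Q 𝔞 n ⟶ N, lof 𝔞 N 0 n (Ext.mk₀ u) = ξ := by
  obtain ⟨n, β, rfl⟩ := lof_exists 𝔞 ξ
  obtain ⟨u, rfl⟩ := Ext.homEquiv₀.symm.surjective β
  exact ⟨n, u, rfl⟩

def ql {N : ModuleCat.{0} R} (n : ℕ) (m : N) (h : ∀ r ∈ 𝔞 ^ n, r • m = 0) : Q 𝔞 n ⟶ N :=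
  ModuleCat.ofHom (Submodule.liftQ _ (LinearMap.toSpanSingleton R N m) (by
    intro r hr; rw [LinearMap.mem_ker, LinearMap.toSpanSingleton_apply]; exact h r hr))

lemma ql_q1 {N : ModuleCat.{0} R} (n : ℕ) (m : N) (h : ∀ r ∈ 𝔞 ^ n, r • m = 0) : 
    (ql 𝔞 n m h).hom (q1 𝔞 n) = m := by
  change (LinearMap.toSpanSingleton R N m) 1 = m
  simp

lemma lof0_smul_eq_zero_iff {n : ℕ} {N : ModuleCat.{0} R} (u : Q 𝔞 n ⟶ N) (r : R) : 
    r • lof 𝔞 N 0 n (Ext.mk₀ u) = 0 ↔ r • u.hom (q1 𝔞 n) = 0 := by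
  rw [← map_smul, ← Ext.mk₀_smul, lof0_eq_zero_iff]; rfl

/-- torsion submodule -/
def tors (M : Type) [AddCommGroup M] [Module R M] : Submodule R M where
  carrier := {m | ∃ n, ∀ r ∈ 𝔞 ^ n, r • m = 0}
  zero_mem' := ⟨0, by simp⟩
  add_mem' := by
    rintro x y ⟨n, hn⟩ ⟨m, hm⟩
    refine ⟨max n m, fun r hr => ?_⟩
    rw [smul_add, hn r (Ideal.pow_le_pow_right (le_max_left _ _) hr), 
      hm r (Ideal.pow_le_pow_right (le_max_right _ _) hr), add_zero]
  smul_mem' := by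
    rintro c x ⟨n, hn⟩
    exact ⟨n, fun r hr => by rw [smul_comm, hn r hr, smul_zero]⟩

lemma lc0_mem_tors {n : ℕ} {N : ModuleCat.{0} R} (u : Q 𝔞 n ⟶ N) : 
    u.hom (q1 𝔞 n) ∈ tors 𝔞 N :=
  ⟨n, fun r hr => by rw [← map_smul, q1_smul 𝔞 n r hr, map_zero]⟩

lemma lc0_eq_zero {N : ModuleCat.{0} R} (h : tors 𝔞 N = ⊥) (ξ : LC 𝔞 N 0) : ξ = 0 := by
  obtain ⟨n, u, rfl⟩ := lof0_exists 𝔞 ξ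
  rw [lof0_eq_zero_iff]
  have := lc0_mem_tors 𝔞 u
  rwa [h, Submodule.mem_bot] at this

lemma ass_mem_iff [IsNoetherianRing R] (N : Type) [AddCommGroup N] [Module R N] (p : Ideal R) :
    p ∈ associatedPrimes R N ↔ p.IsPrime ∧ ∃ x : N, ∀ r, r ∈ p ↔ r • x = 0 := by
  rw [AssociatedPrimes.mem_iff, isAssociatedPrime_iff]
  simp only [Ideal.ext_iff, Submodule.mem_colon_singleton, Submodule.mem_bot]

lemma ass_lc0 [IsNoetherianRing R] (N : ModuleCat.{0} R) : 
    associatedPrimes R (LC 𝔞 N 0) = associatedPrimes R N ∩ {p : Ideal R | 𝔞 ≤ p} := by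
  ext p
  rw [Set.mem_inter_iff, ass_mem_iff, ass_mem_iff, Set.mem_ofPred_eq]
  constructor
  · rintro ⟨hp, ξ, hξ⟩
    obtain ⟨n, u, rfl⟩ := lof0_exists 𝔞 ξ
    simp only [lof0_smul_eq_zero_iff] at hξ
    refine ⟨⟨hp, _, hξ⟩, ?_⟩
    refine hp.le_of_pow_le (n := n) (fun r hr => ?_)
    rw [hξ, ← map_smul, q1_smul 𝔞 n r hr, map_zero]
  · rintro ⟨⟨hp, m, hm⟩, ha⟩
    refine ⟨hp, lof 𝔞 N 0 1 (Ext.mk₀ (ql 𝔞 1 m ?_)), ?_⟩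
    · intro r hr
      rw [← hm]; exact ha (by simpa using hr)
    · intro r
      rw [lof0_smul_eq_zero_iff, ql_q1, hm]

lemma lc0_surj {J N : ModuleCat.{0} R} (g : J ⟶ N) (hg : Function.Surjective g.hom) 
    (hJ : tors 𝔞 J = ⊤) : Function.Surjective (pm 𝔞 g 0) := by
  intro ξ
  obtain ⟨n, u, rfl⟩ := lof0_exists 𝔞 ξ
  obtain ⟨m, hm⟩ := hg (u.hom (q1 𝔞 n))
  obtain ⟨k, hk⟩ : m ∈ tors 𝔞 J := by rw [hJ]; trivial
  have hk' : ∀ r ∈ 𝔞 ^ (max n k), r • m = 0 := fun r hr => hk r (Ideal.pow_le_pow_right (le_max_right _ _) hr)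
  refine ⟨lof 𝔞 J 0 (max n k) (Ext.mk₀ (ql 𝔞 _ m hk')), ?_⟩
  rw [pm, post_lof, Ext.mk₀_comp_mk₀, ← lof_tr 𝔞 (le_max_left n k), Ext.mk₀_comp_mk₀]
  congr 2
  refine qhom_ext 𝔞 _ _ ?_
  change g.hom ((ql 𝔞 _ m hk').hom (q1 𝔞 _)) = u.hom (q1 𝔞 n)
  rw [ql_q1, hm]

lemma ses {A B C : Type} [AddCommGroup A] [Module R A] [AddCommGroup B] [Module R B] [AddCommGroup C]
   [Module R C] (f : A →ₗ[R] B) (g : B →ₗ[R] C) (hf : Function.Injective f) (hg : Function.Surjective g)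
   (hfg : Function.Exact f g) : (ShortComplex.mk (ModuleCat.ofHom f) (ModuleCat.ofHom g) 
      (by ext x; exact hfg.apply_apply_eq_zero x)).ShortExact where
  exact := (ShortComplex.ShortExact.moduleCat_exact_iff_function_exact _).2 hfg
  mono_f := (ModuleCat.mono_iff_injective _).2 hf
  epi_g := (ModuleCat.epi_iff_surjective _).2 hg

lemma tors_fg {X : Type} [AddCommGroup X] [Module R X] (N : Submodule R X) (hN : N.FG) (h : N ≤ tors 𝔞 X) :
    ∃ k, ∀ r ∈ 𝔞 ^ k, ∀ y ∈ N, r • y = 0 := by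
  obtain ⟨s, rfl⟩ := hN
  have h1 : ∀ y : X, ∃ n, y ∈ s → ∀ r ∈ 𝔞 ^ n, r • y = 0 := by
    intro y
    by_cases hy : y ∈ s
    · obtain ⟨n, hn⟩ := h (Submodule.subset_span hy)
      exact ⟨n, fun _ => hn⟩
    · exact ⟨0, fun h => absurd h hy⟩
  choose n hn using h1
  refine ⟨s.sup n, fun r hr y hy => ?_⟩
  induction hy using Submodule.span_induction with
  | mem y hy => exact hn y hy r (Ideal.pow_le_pow_right (Finset.le_sup hy) hr)
  | zero => simp
  | add a b _ _ ha hb => rw [smul_add, ha, hb, add_zero]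
  | smul c a _ ha => rw [smul_comm, ha, smul_zero]

lemma tors_injective [IsNoetherianRing R] (E : Type) [AddCommGroup E] [Module R E] [Module.Injective R E] :
    Module.Injective R (tors 𝔞 E) := by
  apply Module.Baer.injective
  intro I f
  obtain ⟨k, hk⟩ : ∃ k, ∀ r ∈ 𝔞 ^ k, ∀ y : I, r • f y = 0 := by
    obtain ⟨k, hk⟩ := tors_fg 𝔞 (LinearMap.range ((tors 𝔞 E).subtype ∘ₗ f)) 
      (by rw [LinearMap.range_eq_map]; exact (Module.Finite.fg_top (R := R) (M := I)).map _)
      (by rintro _ ⟨y, rfl⟩; exact (f y).2)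
    refine ⟨k, fun r hr y => Subtype.ext ?_⟩
    exact hk r hr _ ⟨y, rfl⟩
  obtain ⟨m, hm⟩ : ∃ m, 𝔞 ^ m ⊓ I ≤ 𝔞 ^ k * I := by
    obtain ⟨c, hc⟩ := Ideal.exists_pow_inf_eq_pow_smul 𝔞 (I : Submodule R R)
    refine ⟨c + k, ?_⟩
    have := hc (c + k) (by omega)
    simp only [smul_eq_mul, Ideal.mul_top, Nat.add_sub_cancel_left] at this
    rw [this]
    exact Ideal.mul_mono_right inf_le_right
  have hker : ∀ y : I, (y : R) ∈ 𝔞 ^ m → f y = 0 := by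
    intro y hy
    have h1 : 𝔞 ^ k * I ≤ (LinearMap.ker f).map I.subtype := by
      rw [Ideal.mul_le]
      intro r hr s hs
      exact ⟨r • ⟨s, hs⟩, by rw [SetLike.mem_coe, LinearMap.mem_ker, map_smul]; exact hk r hr _, rfl⟩
    obtain ⟨y', hy', h2⟩ := h1 (hm ⟨hy, y.2⟩)
    have : y' = y := Subtype.ext h2
    rw [← this]; exact hy'
  let K : Submodule R I := Submodule.comap I.subtype (𝔞 ^ m)
  let a : (I ⧸ K) →ₗ[R] (R ⧸ 𝔞 ^ m) := Submodule.mapQ K (𝔞 ^ m) I.subtype le_rfl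
  have ha : Function.Injective a := by
    rw [← LinearMap.ker_eq_bot, Submodule.ker_mapQ, Submodule.mkQ_map_self]
  let b : (I ⧸ K) →ₗ[R] E := K.liftQ ((tors 𝔞 E).subtype ∘ₗ f) (by
    intro y hy
    rw [LinearMap.mem_ker, LinearMap.comp_apply, hker y hy]; rfl)
  obtain ⟨g, hg⟩ := Module.Injective.out (R := R) (Q := E) a ha b
  let e : E := g (Submodule.Quotient.mk 1)
  have he : e ∈ tors 𝔞 E := by
    refine ⟨m, fun r hr => ?_⟩
    change r • g _ = 0
    rw [← map_smul, ← Submodule.Quotient.mk_smul, (Submodule.Quotient.mk_eq_zero _).2, map_zero]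
    simpa using hr
  refine ⟨LinearMap.toSpanSingleton R _ ⟨e, he⟩, fun y hy => Subtype.ext ?_⟩
  have h3 : g (a (Submodule.Quotient.mk ⟨y, hy⟩)) = f ⟨y, hy⟩ := hg _
  rw [← h3, LinearMap.toSpanSingleton_apply]
  change y • g _ = _
  rw [← map_smul, ← Submodule.Quotient.mk_smul, smul_eq_mul, mul_one]
  rfl

lemma lc_vanish [IsNoetherianRing R] (i : ℕ) : 
    ∀ (U : ModuleCat.{0} R) (_ : tors 𝔞 U = ⊤) (ξ : LC 𝔞 U (i+1)), ξ = 0 := by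
  have key : ∀ (U : ModuleCat.{0} R) (_ : tors 𝔞 U = ⊤), ∃ (S : ShortComplex (ModuleCat.{0} R)) 
      (_ : S.ShortExact) (e : S.X₁ = U), tors 𝔞 S.X₂ = ⊤ ∧ tors 𝔞 S.X₃ = ⊤ ∧ Injective S.X₂ := by
    intro U hU
    let E : ModuleCat.{0} R := Injective.under U
    have hE : Injective E := inferInstanceAs (Injective (Injective.under U))
    have : Module.Injective R E := Module.injective_module_of_injective_object (inj := hE)
    let J := tors 𝔞 E
    have hJ : Module.Injective R J := tors_injective 𝔞 E
    let ι : U →ₗ[R] E := (Injective.ι U).hom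
    have hι : Function.Injective ι := (ModuleCat.mono_iff_injective (Injective.ι U)).1 inferInstance
    let f : U →ₗ[R] J := ι.codRestrict J (by
      intro u
      obtain ⟨n, hn⟩ : u ∈ tors 𝔞 U := by rw [hU]; trivial
      exact ⟨n, fun r hr => by rw [← map_smul, hn r hr, map_zero]⟩)
    have hf : Function.Injective f := fun u v h => hι (congrArg Subtype.val h)
    have tJ : ∀ z : J, ∃ n, ∀ r ∈ 𝔞 ^ n, r • z = 0 := by
      rintro ⟨z, n, hn⟩
      exact ⟨n, fun r hr => Subtype.ext (hn r hr)⟩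
    refine ⟨_, ses f (LinearMap.range f).mkQ hf (Submodule.mkQ_surjective _) ?_, rfl, ?_, ?_, ?_⟩
    · rw [LinearMap.exact_iff, Submodule.ker_mkQ]
    · rw [eq_top_iff]; rintro z -; exact tJ z
    · rw [eq_top_iff]; rintro z -
      obtain ⟨y, rfl⟩ := Submodule.mkQ_surjective _ z
      obtain ⟨n, hn⟩ := tJ y
      exact ⟨n, fun r hr => by rw [← map_smul, hn r hr, map_zero]⟩
    · exact Module.injective_object_of_injective_module R J
  have inj0 : ∀ (J : ModuleCat.{0} R) [Injective J] (k : ℕ) (ξ : LC 𝔞 J (k+1)), ξ = 0 := by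
    intro J _ k ξ
    obtain ⟨n, β, rfl⟩ := lof_exists 𝔞 ξ
    rw [Ext.eq_zero_of_injective β, map_zero]
  induction i with
  | zero => 
    intro U hU ξ
    obtain ⟨S, hS, rfl, h2, h3, hi⟩ := key U hU
    obtain ⟨η, rfl⟩ := lc_exact₁ 𝔞 hS 0 ξ (inj0 _ _ _)
    obtain ⟨ζ, rfl⟩ := lc0_surj 𝔞 S.g ((ModuleCat.epi_iff_surjective _).1 hS.epi_g) h2 η
    rw [dl_pm]
  | succ i ih => 
    intro U hU ξ
    obtain ⟨S, hS, rfl, h2, h3, hi⟩ := key U hU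
    obtain ⟨η, rfl⟩ := lc_exact₁ 𝔞 hS _ ξ (inj0 _ _ _)
    rw [ih _ h3 η, map_zero]
end LC2
end
end LCProof

open CategoryTheory
namespace LCProof
open Opposite Limits
noncomputable section
section LC3
open Abelian
variable {R : Type} [CommRing R] (𝔞 : Ideal R)

lemma tors_kill {M : Type} [AddCommGroup M] [Module R M] (n₀ : ℕ)
    (h : ∀ r ∈ 𝔞 ^ n₀, ∀ ξ : LC 𝔞 (ModuleCat.of R M) 0, r • ξ = 0) (m : M) (hm : m ∈ tors 𝔞 M)
    (r : R) (hr : r ∈ 𝔞 ^ n₀) : r • m = 0 := by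
  obtain ⟨n, hn⟩ := hm
  have h1 := h r hr (lof 𝔞 (ModuleCat.of R M) 0 n (Ext.mk₀ (ql 𝔞 (N := ModuleCat.of R M) n m hn)))
  rw [lof0_smul_eq_zero_iff, ql_q1] at h1
  exact h1

lemma ker_le_tors [IsNoetherianRing R] {M : Type} [AddCommGroup M] [Module R M] (x : R)
    (hfr : ∀ p ∈ associatedPrimes R M, ¬ 𝔞 ≤ p → x ∉ p) (m : M) (hm : x • m = 0) : m ∈ tors 𝔞 M := by
  let P : Submodule R M := Submodule.span R {m}
  have : Module.Finite R P := Module.Finite.iff_fg.2 (Submodule.fg_span_singleton m)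
  have hx : x ∈ Module.annihilator R P := by
    rw [Module.mem_annihilator]
    rintro ⟨y, hy⟩
    obtain ⟨c, rfl⟩ := Submodule.mem_span_singleton.1 hy
    apply Subtype.ext
    change x • c • m = 0
    rw [smul_comm, hm, smul_zero]
  have h1 : 𝔞 ≤ (Module.annihilator R P).radical := by
    rw [← Ideal.sInf_minimalPrimes]
    refine le_sInf fun p hp => ?_
    have h2 : p ∈ associatedPrimes R P :=
      Module.associatedPrimes.minimalPrimes_annihilator_subset_associatedPrimes R P hp
    have h3 : p ∈ associatedPrimes R M :=
      associatedPrimes.subset_of_injective P.injective_subtype h2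
    by_contra h4
    exact hfr p h3 h4 (hp.1.2 hx)
  obtain ⟨k, hk⟩ := Ideal.exists_pow_le_of_le_radical_of_fg h1 (IsNoetherian.noetherian _)
  refine ⟨k, fun r hr => ?_⟩
  have := Module.mem_annihilator.1 (hk hr) ⟨m, Submodule.mem_span_singleton_self m⟩
  exact congrArg Subtype.val this

lemma decomp (I J : Ideal R) (x : R) (hx : x ∈ I * J) : ∃ (ι : Type) (_ : Fintype ι) (y z : ι → R),
    (∀ k, y k ∈ I) ∧ (∀ k, z k ∈ J) ∧ x = ∑ k, y k * z k := by
  refine Submodule.mul_induction_on hx ?_ ?_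
  · intro a ha b hb
    exact ⟨Unit, inferInstance, fun _ => a, fun _ => b, fun _ => ha, fun _ => hb, by simp⟩
  · rintro a b ⟨ι, i1, y, z, hy, hz, h⟩ ⟨ι', i1', y', z', hy', hz', h'⟩
    refine ⟨ι ⊕ ι', inferInstance, Sum.elim y y', Sum.elim z z', ?_, ?_, ?_⟩
    · rintro (k | k)
      · exact hy k
      · exact hy' k
    · rintro (k | k)
      · exact hz k
      · exact hz' k
    · rw [Fintype.sum_sum_type, h, h']; rfl

lemma core {M Mb N : Type} [AddCommGroup M] [Module R M] [AddCommGroup Mb] [Module R Mb]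
    [AddCommGroup N] [Module R N] (xb : Mb →ₗ[R] M) (π : M →ₗ[R] N) (hxb : Function.Injective xb)
    (hπ : Function.Surjective π) (hex : Function.Exact xb π) {ι : Type} [Fintype ι]
    (y : ι → (Mb →ₗ[R] M)) (z : ι → R) (hxy : ∀ m, xb m = ∑ k, y k (z k • m)) (i : ℕ)
    (hy : ∀ k, ∀ ξ : LC 𝔞 (ModuleCat.of R Mb) i, pm 𝔞 (ModuleCat.ofHom (y k)) i ξ = 0) :
    (∀ ξ : LC 𝔞 (ModuleCat.of R Mb) (i+1), (∀ k, z k • ξ = 0) →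
      ∃ ζ : LC 𝔞 (ModuleCat.of R N) i, dl 𝔞 (ses xb π hxb hπ hex) i ζ = ξ ∧ ∀ r : R, r • ξ = 0 → r • ζ = 0) ∧
    ∀ ξ : LC 𝔞 (ModuleCat.of R Mb) i, pm 𝔞 (ModuleCat.ofHom xb) i ξ = 0 := by
  classical
  let zh : Mb →ₗ[R] (ι → Mb) := LinearMap.pi (fun k => z k • LinearMap.id)
  let yh : (ι → Mb) →ₗ[R] M := ∑ k, y k ∘ₗ LinearMap.proj k
  have hyz : ∀ m, yh (zh m) = xb m := by
    intro m
    rw [hxy]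
    simp [yh, zh]
  have hzh : Function.Injective zh := by
    intro a b h
    apply hxb
    rw [← hyz, ← hyz, h]
  have hpy : ∀ ξ, pm 𝔞 (ModuleCat.ofHom yh) i ξ = 0 := by
    intro ξ
    have : ModuleCat.ofHom yh = ∑ k, ModuleCat.ofHom (LinearMap.proj k) ≫ ModuleCat.ofHom (y k) := by
      ext v
      simp [yh]
    rw [this, pm_sum]
    exact Finset.sum_eq_zero fun k _ => by rw [pm_comp, hy]
  refine ⟨?_, ?_⟩
  · intro ξ hξ
    have hpz : pm 𝔞 (ModuleCat.ofHom zh) (i+1) ξ = 0 := by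
      have : ModuleCat.ofHom zh = ∑ k, z k • ModuleCat.ofHom (LinearMap.single R (fun _ : ι => Mb) k) := by
        ext v
        simp [zh, Finset.sum_apply, Pi.single_apply]
      rw [this, pm_sum]
      exact Finset.sum_eq_zero fun k _ => by rw [pm_smul, ← map_smul, hξ, map_zero]
    have hex3 : Function.Exact zh (LinearMap.range zh).mkQ := by
      rw [LinearMap.exact_iff, Submodule.ker_mkQ]
    let hS := ses zh (LinearMap.range zh).mkQ hzh (Submodule.mkQ_surjective _) hex3
    let c : ((ι → Mb) ⧸ LinearMap.range zh) →ₗ[R] N := (LinearMap.range zh).liftQ (π ∘ₗ yh) (by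
      rintro _ ⟨m, rfl⟩
      rw [LinearMap.mem_ker, LinearMap.comp_apply, hyz]
      exact hex.apply_apply_eq_zero m)
    let hS2 := ses xb π hxb hπ hex
    let φ : ShortComplex.mk (ModuleCat.ofHom zh) (ModuleCat.ofHom (LinearMap.range zh).mkQ) (by ext m; exact hex3.apply_apply_eq_zero m) ⟶
       ShortComplex.mk (ModuleCat.ofHom xb) (ModuleCat.ofHom π) (by ext m; exact hex.apply_apply_eq_zero m) :=
      { τ₁ := 𝟙 _
        τ₂ := ModuleCat.ofHom yh
        τ₃ := ModuleCat.ofHom c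
        comm₁₂ := by ext m; exact (hyz m).symm
        comm₂₃ := by ext m; rfl }
    obtain ⟨ξ', h'⟩ := lc_exact₁ 𝔞 hS i ξ hpz
    refine ⟨pm 𝔞 (ModuleCat.ofHom c) i ξ', ?_, ?_⟩
    · have := dl_nat 𝔞 hS hS2 φ i ξ'
      rw [h'] at this
      refine this.trans (pm_id _ _ _ _)
    · intro r hr
      obtain ⟨η, hη⟩ := lc_exact₃ 𝔞 hS i (r • ξ') (by rw [map_smul, h', hr])
      rw [← map_smul, ← hη, ← pm_comp]
      have : ModuleCat.ofHom (LinearMap.range zh).mkQ ≫ ModuleCat.ofHom c = 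
        ModuleCat.ofHom yh ≫ ModuleCat.ofHom π := by ext m; rfl
      refine (congrArg (fun u => pm 𝔞 u i η) this).trans ?_
      dsimp only
      rw [pm_comp, hpy, map_zero]
  · intro ξ
    have : ModuleCat.ofHom xb = ModuleCat.ofHom zh ≫ ModuleCat.ofHom yh := by
      ext m; exact (hyz m).symm
    rw [this, pm_comp, hpy]

lemma alg [IsNoetherianRing R] (I : Ideal R) {A B C : Type} [AddCommGroup A] [Module R A] [AddCommGroup B] [Module R B]
    [AddCommGroup C] [Module R C] (f : A →ₗ[R] B) (g : B →ₗ[R] C) (hf : Function.Injective f)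
    (hfg : Function.Exact f g) 
    (hl : ∀ ξ : C, (∀ a ∈ I, a • ξ = 0) → ∃ ζ, g ζ = ξ ∧ ∀ r : R, r • ξ = 0 → r • ζ = 0) 
    (hA : ∀ a ∈ I, ∀ ξ : A, a • ξ = 0) :
    ((∀ a ∈ I, ∀ ξ : C, a • ξ = 0) → ∀ a ∈ I, ∀ ξ : B, a • ξ = 0) ∧
    ((∀ (p : Ideal R) (ξ : C), p.IsPrime → (∀ r, r ∈ p ↔ r • ξ = 0) → I ≤ p) → 
      associatedPrimes R B = associatedPrimes R A ∪ associatedPrimes R C) := by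
  refine ⟨?_, ?_⟩
  · intro hC r hr ξ
    obtain ⟨ζ, hζ, hζ'⟩ := hl (g ξ) (fun a ha => hC a ha _)
    obtain ⟨η, hη⟩ := (hfg (ξ - ζ)).1 (by rw [map_sub, hζ, sub_self])
    have h2 : r • (ξ - ζ) = 0 := by
      rw [← hη, ← map_smul, hA r hr, map_zero]
    rw [smul_sub, hζ' r (hC r hr _), sub_zero] at h2
    exact h2
  · intro ht
    apply Set.Subset.antisymm
    · exact associatedPrimes.subset_union_of_exact hf hfg
    · refine Set.union_subset (associatedPrimes.subset_of_injective hf) ?_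
      intro p hp
      rw [ass_mem_iff] at hp ⊢
      obtain ⟨hp, ξ, hξ⟩ := hp
      refine ⟨hp, ?_⟩
      obtain ⟨ζ, hζ, hζ'⟩ := hl ξ (fun a ha => (hξ _).1 (ht p ξ hp hξ ha))
      refine ⟨ζ, fun r => ?_⟩
      rw [hξ]
      refine ⟨hζ' r, fun h => ?_⟩
      rw [← hζ, ← map_smul, h, map_zero]

lemma lc_exact₃' (i : ℕ) {S : ShortComplex (ModuleCat.{0} R)} (hS : S.ShortExact) : 
    Function.Exact (pm 𝔞 S.g i) (dl 𝔞 hS i) := by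
  intro ξ
  constructor
  · intro h; exact lc_exact₃ 𝔞 hS i ξ h
  · rintro ⟨η, rfl⟩; exact dl_pm 𝔞 hS i η

set_option maxHeartbeats 2000000 in
lemma step [IsNoetherianRing R] {M N : Type} [AddCommGroup M] [Module R M]
    [AddCommGroup N] [Module R N] (π : M →ₗ[R] N) (hπ : Function.Surjective π) (x : R) 
    (hker : ∀ m, π m = 0 ↔ ∃ m', x • m' = m) (n₀ : ℕ) (hn₀ : 0 < n₀) (hx : x ∈ 𝔞 ^ (2 * n₀))
    (hfr : ∀ p ∈ associatedPrimes R M, ¬ 𝔞 ≤ p → x ∉ p) (s : ℕ) (hs : 0 < s) 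
    (hk : ∀ i < s, ∀ r ∈ 𝔞 ^ n₀, ∀ ξ : LC 𝔞 (ModuleCat.of R M) i, r • ξ = 0) :
    (∀ i, i + 1 < s → ∀ r ∈ 𝔞 ^ n₀, ∀ ξ : LC 𝔞 (ModuleCat.of R N) i, r • ξ = 0) ∧ 
    ∀ i < s, associatedPrimes R (LC 𝔞 (ModuleCat.of R N) i) = 
      associatedPrimes R (LC 𝔞 (ModuleCat.of R M) i) ∪ 
      associatedPrimes R (LC 𝔞 (ModuleCat.of R M) (i+1)) := by
  let U := tors 𝔞 M
  have hUk : ∀ m ∈ U, ∀ r ∈ 𝔞 ^ n₀, r • m = 0 := fun m hm r hr => 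
    tors_kill 𝔞 n₀ (hk 0 hs) m hm r hr
  have tU : tors 𝔞 U = ⊤ := by
    rw [eq_top_iff]; rintro ⟨z, hz⟩ -
    obtain ⟨n, hn⟩ := hz
    exact ⟨n, fun r hr => Subtype.ext (hn r hr)⟩
  have tMb : tors 𝔞 (M ⧸ U) = ⊥ := by
    rw [eq_bot_iff]; rintro z ⟨n, hn⟩
    obtain ⟨m, rfl⟩ := U.mkQ_surjective z
    rw [Submodule.mem_bot, Submodule.mkQ_apply, Submodule.Quotient.mk_eq_zero]
    refine ⟨n₀ + n, fun r hr => ?_⟩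
    have : 𝔞 ^ n₀ * 𝔞 ^ n ≤ LinearMap.ker (LinearMap.toSpanSingleton R M m) := by
      rw [Ideal.mul_le]
      intro a ha b hb
      rw [LinearMap.mem_ker, LinearMap.toSpanSingleton_apply, mul_smul]
      refine hUk _ ?_ a ha
      have := hn b hb
      rwa [← map_smul, Submodule.mkQ_apply, Submodule.Quotient.mk_eq_zero] at this
    rw [pow_add] at hr
    have := this hr
    rwa [LinearMap.mem_ker, LinearMap.toSpanSingleton_apply] at this
  have hUex : Function.Exact U.subtype U.mkQ := by
    rw [LinearMap.exact_iff, Submodule.ker_mkQ, Submodule.range_subtype]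
  let hS1 := ses U.subtype U.mkQ U.injective_subtype U.mkQ_surjective hUex
  have qsurj : ∀ i, Function.Surjective (pm 𝔞 (ModuleCat.ofHom U.mkQ) i) := by
    intro i ξ
    exact lc_exact₃ 𝔞 hS1 i ξ (lc_vanish 𝔞 i _ tU _)
  have qinj : ∀ i, Function.Injective (pm 𝔞 (ModuleCat.ofHom U.mkQ) (i+1)) := by
    intro i
    rw [injective_iff_map_eq_zero]
    intro ξ hξ
    obtain ⟨η, rfl⟩ := lc_exact₂ 𝔞 hS1 (i+1) ξ hξ
    rw [lc_vanish 𝔞 i _ tU η, map_zero]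
  rw [two_mul, pow_add] at hx
  obtain ⟨ι, _, y, z, hy, hz, hxyz⟩ := decomp _ _ x hx
  have hx1 : x ∈ 𝔞 ^ n₀ := Ideal.mul_le_left hx
  let L : ∀ r ∈ 𝔞 ^ n₀, (M ⧸ U) →ₗ[R] M := fun r hr => U.liftQ (r • LinearMap.id) (by
    intro m hm
    rw [LinearMap.mem_ker]
    exact hUk m hm r hr)
  have hL : ∀ r hr m, L r hr (U.mkQ m) = r • m := fun r hr m => rfl
  have hLinj : Function.Injective (L x hx1) := by
    rw [injective_iff_map_eq_zero]
    intro m hm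
    obtain ⟨m, rfl⟩ := U.mkQ_surjective m
    rw [hL x hx1 m] at hm
    rw [Submodule.mkQ_apply, Submodule.Quotient.mk_eq_zero]
    exact ker_le_tors 𝔞 x hfr m hm
  have hex : Function.Exact (L x hx1) π := by
    intro m
    rw [hker]
    constructor
    · rintro ⟨m', rfl⟩
      exact ⟨U.mkQ m', hL x hx1 m'⟩
    · rintro ⟨m', rfl⟩
      obtain ⟨m', rfl⟩ := U.mkQ_surjective m'
      exact ⟨m', rfl⟩
  have hsum : ∀ m, L x hx1 m = ∑ k, L (y k) (hy k) (z k • m) := by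
    intro m
    obtain ⟨m, rfl⟩ := U.mkQ_surjective m
    simp only [← map_smul U.mkQ, hL]
    rw [hxyz, Finset.sum_smul]
    simp only [mul_smul]
  have hy0 : ∀ i < s, ∀ k, ∀ ξ : LC 𝔞 (ModuleCat.of R (M ⧸ U)) i, 
      pm 𝔞 (ModuleCat.ofHom (L (y k) (hy k))) i ξ = 0 := by
    intro i hi k ξ
    obtain ⟨η, rfl⟩ := qsurj i ξ
    rw [← pm_comp]
    have : ModuleCat.ofHom U.mkQ ≫ ModuleCat.ofHom (L (y k) (hy k)) = y k • 𝟙 _ := by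
      ext m; rfl
    rw [this, pm_smul, pm_id]
    exact hk i hi _ (hy k) _
  let hS2 := ses (L x hx1) π hLinj hπ hex
  have hinj : ∀ i < s, Function.Injective (pm 𝔞 (ModuleCat.ofHom π) i) := by
    intro i hi
    rw [injective_iff_map_eq_zero]
    intro ξ hξ
    obtain ⟨η, rfl⟩ := lc_exact₂ 𝔞 hS2 i ξ hξ
    exact (core 𝔞 (L x hx1) π hLinj hπ hex _ z hsum i (hy0 i hi)).2 η
  have hlift := fun i hi => (core 𝔞 (L x hx1) π hLinj hπ hex _ z hsum i (hy0 i hi)).1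
  have halg := fun i (hi : i < s) => alg (𝔞 ^ n₀) (A := LC 𝔞 (ModuleCat.of R M) i) (B := LC 𝔞 (ModuleCat.of R N) i) 
    (C := LC 𝔞 (ModuleCat.of R (M ⧸ U)) (i+1)) _ _ (hinj i hi) (lc_exact₃' 𝔞 i hS2) 
    (fun ξ h => hlift i hi ξ (fun k => h _ (hz k))) (hk i hi)
  refine ⟨?_, ?_⟩
  · intro i hi 
    refine (halg i (by omega)).1 ?_
    intro a ha ξ
    obtain ⟨η, hη⟩ := qsurj (i+1) ξ
    have h3 : pm 𝔞 (ModuleCat.ofHom U.mkQ) (i+1) (a • η) = 0 :=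
      (congrArg _ (hk (i+1) hi a ha η)).trans (map_zero _)
    rw [← hη, ← map_smul, h3]
  · intro i hi
    have e : associatedPrimes R (LC 𝔞 (ModuleCat.of R M) (i+1)) = 
        associatedPrimes R (LC 𝔞 (ModuleCat.of R (M ⧸ U)) (i+1)) :=
      LinearEquiv.AssociatedPrimes.eq (LinearEquiv.ofBijective _ ⟨qinj i, qsurj (i+1)⟩)
    rw [e]
    refine (halg i hi).2 ?_
    intro p ξ hp hξ
    obtain ⟨n, hn⟩ := lc_torsion 𝔞 ξ
    have h1 : 𝔞 ≤ p := hp.le_of_pow_le (n := n) fun r hr => (hξ r).2 (hn r hr)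
    exact (Ideal.pow_le_self hn₀.ne').trans h1

def lcEquiv {M N : Type} [AddCommGroup M] [Module R M] [AddCommGroup N] [Module R N] (e : M ≃ₗ[R] N) (i : ℕ) :
    LC 𝔞 (ModuleCat.of R M) i ≃ₗ[R] LC 𝔞 (ModuleCat.of R N) i :=
  LinearEquiv.ofLinearMap (pm 𝔞 (ModuleCat.ofHom e.toLinearMap) i) (pm 𝔞 (ModuleCat.ofHom e.symm.toLinearMap) i)
    (by
      refine LinearMap.ext fun ξ => ?_
      rw [LinearMap.comp_apply, ← pm_comp, ← ModuleCat.ofHom_comp]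
      rw [LinearEquiv.comp_coe, LinearEquiv.symm_trans_self]
      exact pm_id _ _ _ _)
    (by
      refine LinearMap.ext fun ξ => ?_
      rw [LinearMap.comp_apply, ← pm_comp, ← ModuleCat.ofHom_comp]
      rw [LinearEquiv.comp_coe, LinearEquiv.self_trans_symm]
      exact pm_id _ _ _ _)

lemma main_ind [IsNoetherianRing R] (M : Type) [AddCommGroup M] [Module R M] 
    (t n₀ : ℕ) (hn₀ : 0 < n₀)
    (hann : ∀ i < t, ∀ r ∈ 𝔞 ^ n₀, ∀ ξ : LC 𝔞 (ModuleCat.of R M) i, r • ξ = 0)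
    (x : ℕ → R) (hx : ∀ j < t, x j ∈ 𝔞 ^ (2 * n₀))
    (hfr : ∀ j < t, ∀ p ∈ associatedPrimes R
        (M ⧸ (Ideal.span (x '' Set.Iio j) • (⊤ : Submodule R M))), ¬ 𝔞 ≤ p → x j ∉ p) (k : ℕ) (hkt : k ≤ t) :
    (∀ i < t - k, ∀ r ∈ 𝔞 ^ n₀, ∀ ξ : LC 𝔞 (ModuleCat.of R 
      (M ⧸ (Ideal.span (x '' Set.Iio k) • (⊤ : Submodule R M)))) i, r • ξ = 0) ∧
    ∀ m, k + m ≤ t → (⋃ i ∈ Set.Iic m, associatedPrimes R (LC 𝔞 (ModuleCat.of R 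
      (M ⧸ (Ideal.span (x '' Set.Iio k) • (⊤ : Submodule R M)))) i)) = 
      ⋃ i ∈ Set.Iic (k + m), associatedPrimes R (LC 𝔞 (ModuleCat.of R M) i) := by
  induction k with
  | zero =>
    have h0 : (Ideal.span (x '' Set.Iio 0) • (⊤ : Submodule R M)) = ⊥ := by
      have : Set.Iio 0 = (∅ : Set ℕ) := by ext; simp
      rw [this, Set.image_empty, Ideal.span_empty, Submodule.bot_smul]
    let e := Submodule.quotEquivOfEqBot _ h0
    refine ⟨?_, ?_⟩
    · intro i hi r hr ξ
      apply (lcEquiv 𝔞 e i).injective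
      rw [map_smul, map_zero]
      exact hann i (by omega) r hr _
    · intro m hm
      rw [zero_add]
      refine Set.iUnion_congr fun i => Set.iUnion_congr fun _ => ?_
      exact LinearEquiv.AssociatedPrimes.eq (lcEquiv 𝔞 e i)
  | succ k ih =>
    obtain ⟨ih1, ih2⟩ := ih (by omega)
    have hspan : (Ideal.span (x '' Set.Iio (k+1)) • (⊤ : Submodule R M)) = 
        Ideal.span (x '' Set.Iio k) • (⊤ : Submodule R M) ⊔ Ideal.span {x k} • ⊤ := by
      have : Set.Iio (k+1) = Set.Iio k ∪ {k} := by ext n; simp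
      rw [this, Set.image_union, Ideal.span_union, Submodule.sup_smul, Set.image_singleton]
    have hle : (Ideal.span (x '' Set.Iio k) • (⊤ : Submodule R M)) ≤ 
      Ideal.span (x '' Set.Iio (k+1)) • (⊤ : Submodule R M) := by rw [hspan]; exact le_sup_left
    obtain ⟨h1, h2⟩ := step 𝔞 (Submodule.factor hle) (Submodule.factor_surjective hle) (x k) (by
      intro m
      obtain ⟨m, rfl⟩ := Submodule.mkQ_surjective _ m
      rw [Submodule.factor_mk, Submodule.mkQ_apply, Submodule.mkQ_apply, Submodule.Quotient.mk_eq_zero, hspan, Submodule.mem_sup]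
      constructor
      · rintro ⟨a, ha, b, hb, rfl⟩
        rw [Submodule.ideal_span_singleton_smul] at hb
        obtain ⟨m', -, rfl⟩ := hb
        refine ⟨Submodule.mkQ _ m', ?_⟩
        rw [← map_smul, Submodule.mkQ_apply, Submodule.Quotient.eq]
        simpa using ha
      · rintro ⟨m', hm'⟩
        obtain ⟨m', rfl⟩ := Submodule.mkQ_surjective _ m'
        rw [← map_smul, Submodule.mkQ_apply, Submodule.Quotient.eq] at hm'
        refine ⟨m - x k • m', ?_, x k • m', ?_, by abel⟩
        · rw [← neg_sub]; exact neg_mem hm'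
        · exact Submodule.smul_mem_smul (Ideal.mem_span_singleton_self _) trivial) 
      n₀ hn₀ (hx k (by omega)) (hfr k (by omega)) (t - k) (by omega) ih1
    refine ⟨fun i hi => h1 i (by omega), fun m hm => ?_⟩
    rw [show k + 1 + m = k + (m + 1) by omega, ← ih2 (m+1) (by omega)]
    ext p
    simp only [Set.mem_iUnion, Set.mem_Iic, exists_prop]
    constructor
    · rintro ⟨i, hi, hp⟩
      rw [h2 i (by omega)] at hp
      rcases hp with hp | hp
      · exact ⟨i, by omega, hp⟩
      · exact ⟨i+1, by omega, hp⟩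
    · rintro ⟨i, hi, hp⟩
      rcases Nat.lt_or_ge m i with h | h
      · obtain rfl : i = m + 1 := by omega
        refine ⟨m, le_rfl, ?_⟩
        rw [h2 m (by omega)]
        exact Or.inr hp
      · refine ⟨i, h, ?_⟩
        rw [h2 i (by omega)]
        exact Or.inl hp

end LC3
end
end LCProof

theorem biUnion_associatedPrimes_localCohomology_eq
    {R : Type} [CommRing R] [IsNoetherianRing R] (𝔞 : Ideal R)
    (M : Type) [AddCommGroup M] [Module R M] [Module.Finite R M]
    (t n₀ : ℕ) (ht : 0 < t) (hn₀ : 0 < n₀)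
    (hann : ∀ i < t, 𝔞 ^ n₀ ≤ Module.annihilator R
      ((localCohomology 𝔞 i).obj (ModuleCat.of R M)))
    (x : ℕ → R) (hx : ∀ j < t, x j ∈ 𝔞 ^ (2 * n₀))
    (hfr : ∀ j < t, ∀ p ∈ associatedPrimes R
        (M ⧸ (Ideal.span (x '' Set.Iio j) • (⊤ : Submodule R M))), ¬ 𝔞 ≤ p → x j ∉ p)
    (j : ℕ) (hj : 1 ≤ j) (hjt : j ≤ t) :
    (⋃ i ∈ Set.Iic j,
        associatedPrimes R ((localCohomology 𝔞 i).obj (ModuleCat.of R M))) =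
      associatedPrimes R (M ⧸ (Ideal.span (x '' Set.Iio j) • (⊤ : Submodule R M))) ∩
        {p : Ideal R | 𝔞 ≤ p} := by
  have hann' : ∀ i < t, ∀ r ∈ 𝔞 ^ n₀, ∀ ξ : LCProof.LC 𝔞 (ModuleCat.of R M) i, r • ξ = 0 := by
    intro i hi r hr ξ
    have h := Module.mem_annihilator.1 (hann i hi hr) ((LCProof.equivLC 𝔞 (ModuleCat.of R M) i).symm ξ)
    rw [← map_smul] at h
    exact (LinearEquiv.map_eq_zero_iff _).1 h
  have h := (LCProof.main_ind 𝔞 M t n₀ hn₀ hann' x hx hfr j hjt).2 0 hjt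
  have h' : (⋃ i ∈ Set.Iic j,
        associatedPrimes R ((localCohomology 𝔞 i).obj (ModuleCat.of R M))) = 
        ⋃ i ∈ Set.Iic (j + 0), associatedPrimes R (LCProof.LC 𝔞 (ModuleCat.of R M) i) :=
    Set.iUnion_congr fun i => Set.iUnion_congr fun _ => 
      LinearEquiv.AssociatedPrimes.eq (LCProof.equivLC 𝔞 (ModuleCat.of R M) i)
  rw [h', ← h, ← LCProof.ass_lc0 𝔞 (ModuleCat.of R _)]
  simp
end

section
/- Let R be a commutative Noetherian ring, 𝔞 an ideal, M a finitely generated R-module, and t a positive integer such that the local cohomology modules H^i_𝔞(M) are finitely generated for all i < t. Then the set of associated primes Ass(H^t_𝔞(M)) is finite. -/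
namespace LCAux

open CategoryTheory Limits Opposite

section Op
variable {R : Type} [CommRing R] (K : ChainComplex (ModuleCat.{0} R)ᵒᵖ ℕ) (n : ℕ)

lemma pOp_inj : Function.Injective (K.pOpcycles n).unop := by
  rw [← ModuleCat.mono_iff_injective]; infer_instance

lemma hI_surj : Function.Surjective (K.homologyι n).unop := by
  rw [← ModuleCat.epi_iff_surjective]; infer_instance

lemma pOp_range (f : (K.X n).unop) (hf : (K.d (n+1) n).unop f = 0) :
    ∃ z : (K.opcycles n).unop, (K.pOpcycles n).unop z = f := by
  have h := ShortComplex.exact_of_g_is_cokernel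
    (ShortComplex.mk _ _ (K.d_pOpcycles (n+1) n)) (K.opcyclesIsCokernel (n+1) n (by simp))
  have h2 := h.unop
  rw [ShortComplex.moduleCat_exact_iff] at h2
  exact h2 f hf

lemma pOp_d (z : (K.opcycles n).unop) : (K.d (n+1) n).unop ((K.pOpcycles n).unop z) = 0 := by
  have := congrArg (fun g => g.unop z) (K.d_pOpcycles (n+1) n)
  exact this

lemma hI_ker (z : (K.opcycles n).unop) (j : ℕ) (hj : (ComplexShape.down ℕ).next n = j)
    (hz : (K.homologyι n).unop z = 0) : ∃ g : (K.X j).unop, (K.fromOpcycles n j).unop g = z := by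
  have h := ShortComplex.exact_of_f_is_kernel
    (ShortComplex.mk _ _ (K.homologyι_comp_fromOpcycles n j)) (K.homologyIsKernel n j hj)
  have h2 := h.unop
  rw [ShortComplex.moduleCat_exact_iff] at h2
  exact h2 z hz

lemma hI_from (j : ℕ) (g : (K.X j).unop) :
    (K.homologyι n).unop ((K.fromOpcycles n j).unop g) = 0 := by
  have := congrArg (fun h => h.unop g) (K.homologyι_comp_fromOpcycles n j)
  exact this

lemma pOp_from (j : ℕ) (g : (K.X j).unop) :
    (K.pOpcycles n).unop ((K.fromOpcycles n j).unop g) = (K.d n j).unop g := by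
  have := congrArg (fun h => h.unop g) (K.p_fromOpcycles n j)
  exact this

lemma hI_pOp (j : ℕ) (hj : (ComplexShape.down ℕ).next n = j) (z : (K.opcycles n).unop) :
    (K.homologyι n).unop z = 0 ↔
      ∃ g : (K.X j).unop, (K.d n j).unop g = (K.pOpcycles n).unop z := by
  constructor
  · intro h
    obtain ⟨g, rfl⟩ := hI_ker K n z j hj h
    exact ⟨g, (pOp_from K n j g).symm⟩
  · rintro ⟨g, hg⟩
    rw [← pOp_from] at hg
    rw [← pOp_inj K n hg, hI_from]

end Op

section Cmp
variable {R : Type} [CommRing R]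

open Abelian

lemma extMk_zero_deg {X Y : ModuleCat.{0} R} (P : ProjectiveResolution X) (f : P.complex.X 0 ⟶ Y)
    (hf : P.complex.d 1 0 ≫ f = 0) (h : P.extMk f 1 rfl hf = 0) : f = 0 := by
  rw [← P.extEquivCohomologyClass.apply_eq_iff_eq,
    ProjectiveResolution.extEquivCohomologyClass_extMk,
    ProjectiveResolution.extEquivCohomologyClass_zero,
    CochainComplex.HomComplex.CohomologyClass.mk_eq_zero_iff] at h
  rw [CochainComplex.HomComplex.Cocycle.toSingleMk_mem_coboundaries_iff _ _ _ _ _ 1 (by simp)] at h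
  obtain ⟨g, hg⟩ := h
  have : g = 0 := (CochainComplex.isZero_of_isStrictlyLE P.cochainComplex 0 1).eq_of_src _ _
  rw [this, comp_zero] at hg
  rw [← cancel_epi (P.cochainComplexXIso (-(0:ℕ)) 0 rfl).hom, ← hg, comp_zero]

/-- complex computing old Ext -/
noncomputable abbrev KK {X : ModuleCat.{0} R} (P : ProjectiveResolution X) (Y : ModuleCat.{0} R) :
    ChainComplex (ModuleCat.{0} R)ᵒᵖ ℕ :=
  ((((linearYoneda R (ModuleCat.{0} R)).obj Y).rightOp.mapHomologicalComplex _).obj P.complex)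

/-- cocycle underlying -/
noncomputable def coc {X : ModuleCat.{0} R} (P : ProjectiveResolution X) (Y : ModuleCat.{0} R)
    (n : ℕ) (z : ((KK P Y).opcycles n).unop) : P.complex.X n ⟶ Y :=
  ((KK P Y).pOpcycles n).unop z

lemma coc_d {X : ModuleCat.{0} R} (P : ProjectiveResolution X) (Y : ModuleCat.{0} R)
    (n : ℕ) (z : ((KK P Y).opcycles n).unop) : P.complex.d (n+1) n ≫ coc P Y n z = 0 :=
  pOp_d (KK P Y) n z

lemma extMk_smul {X Y : ModuleCat.{0} R} (P : ProjectiveResolution X) {n : ℕ}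
    (f : P.complex.X n ⟶ Y)
    (hf : P.complex.d (n+1) n ≫ f = 0) (r : R) :
    P.extMk (r • f) (n+1) rfl (by simp [hf]) = r • P.extMk f (n+1) rfl hf := by
  rw [Ext.smul_eq_comp_mk₀, ProjectiveResolution.extMk_comp_mk₀]
  simp

/-- from opcycles to Ext -/
noncomputable def toNew {X : ModuleCat.{0} R} (P : ProjectiveResolution X) (Y : ModuleCat.{0} R)
    (n : ℕ) : ((KK P Y).opcycles n).unop →ₗ[R] Abelian.Ext X Y n where
  toFun z := P.extMk (coc P Y n z) (n+1) rfl (coc_d P Y n z)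
  map_add' a b := by
    rw [ProjectiveResolution.add_extMk]
    congr 1
    exact map_add _ _ _
  map_smul' r a := by
    dsimp only [RingHom.id_apply]
    rw [← extMk_smul]
    congr 1
    exact map_smul (((KK P Y).pOpcycles n).unop).hom _ _

lemma toNew_apply {X : ModuleCat.{0} R} (P : ProjectiveResolution X) (Y : ModuleCat.{0} R)
    (n : ℕ) (z : ((KK P Y).opcycles n).unop) :
    toNew P Y n z = P.extMk (coc P Y n z) (n+1) rfl (coc_d P Y n z) := rfl

/-- from opcycles to the old Ext -/
noncomputable def toOld {X : ModuleCat.{0} R} (P : ProjectiveResolution X) (Y : ModuleCat.{0} R)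
    (n : ℕ) : ((KK P Y).opcycles n).unop →ₗ[R]
      ((_root_.Ext R (ModuleCat.{0} R) n).obj (op X)).obj Y :=
  (((P.isoLeftDerivedObj ((linearYoneda R (ModuleCat.{0} R)).obj Y).rightOp n).hom ≫
    (KK P Y).homologyι n).unop).hom

lemma toOld_surj {X : ModuleCat.{0} R} (P : ProjectiveResolution X) (Y : ModuleCat.{0} R)
    (n : ℕ) : Function.Surjective (toOld P Y n) := by
  have : Epi (P.isoLeftDerivedObj ((linearYoneda R (ModuleCat.{0} R)).obj Y).rightOp n).hom.unop :=
    inferInstance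
  have := (ModuleCat.epi_iff_surjective _).1 this
  exact this.comp (hI_surj (KK P Y) n)

lemma toOld_zero {X : ModuleCat.{0} R} (P : ProjectiveResolution X) (Y : ModuleCat.{0} R)
    (n : ℕ) (z : ((KK P Y).opcycles n).unop) :
    toOld P Y n z = 0 ↔ ((KK P Y).homologyι n).unop z = 0 := by
  have : Mono (P.isoLeftDerivedObj ((linearYoneda R (ModuleCat.{0} R)).obj Y).rightOp n).hom.unop :=
    inferInstance
  have := (ModuleCat.mono_iff_injective _).1 this
  exact map_eq_zero_iff _ this

lemma toNew_surj {X : ModuleCat.{0} R} (P : ProjectiveResolution X) (Y : ModuleCat.{0} R)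
    (n : ℕ) : Function.Surjective (toNew P Y n) := by
  intro α
  obtain ⟨f, hf, rfl⟩ := P.extMk_surjective α (n+1) rfl
  obtain ⟨z, hz⟩ := pOp_range (KK P Y) n f hf
  refine ⟨z, ?_⟩
  rw [toNew_apply]
  congr 1

lemma ker_eq {X : ModuleCat.{0} R} (P : ProjectiveResolution X) (Y : ModuleCat.{0} R)
    (n : ℕ) : LinearMap.ker (toOld P Y n) = LinearMap.ker (toNew P Y n) := by
  ext z
  rw [LinearMap.mem_ker, LinearMap.mem_ker, toOld_zero]
  rcases n with _ | n
  · rw [hI_pOp (KK P Y) 0 0 (by simp)]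
    have h0 : (KK P Y).d 0 0 = 0 := (KK P Y).shape _ _ (by simp)
    constructor
    · rintro ⟨g, hg⟩
      have : coc P Y 0 z = 0 := by
        rw [h0] at hg; exact hg.symm
      rw [toNew_apply]
      simp [this]
    · intro h
      refine ⟨0, ?_⟩
      have := extMk_zero_deg P _ (coc_d P Y 0 z) h
      rw [h0]; exact this.symm
  · rw [hI_pOp (KK P Y) (n+1) n (by simp)]
    rw [toNew_apply]
    rw [P.extMk_eq_zero_iff _ _ _ _ n rfl]
    rfl

/-- the comparison -/
noncomputable def cmp {X : ModuleCat.{0} R} (P : ProjectiveResolution X) (Y : ModuleCat.{0} R)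
    (n : ℕ) : ((_root_.Ext R (ModuleCat.{0} R) n).obj (op X)).obj Y ≃ₗ[R] Abelian.Ext X Y n :=
  ((toOld P Y n).quotKerEquivOfSurjective (toOld_surj P Y n)).symm ≪≫ₗ
    Submodule.quotEquivOfEq _ _ (ker_eq P Y n) ≪≫ₗ
    (toNew P Y n).quotKerEquivOfSurjective (toNew_surj P Y n)

lemma cmp_toOld {X : ModuleCat.{0} R} (P : ProjectiveResolution X) (Y : ModuleCat.{0} R)
    (n : ℕ) (z : ((KK P Y).opcycles n).unop) : cmp P Y n (toOld P Y n z) = toNew P Y n z := by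
  have : ((toOld P Y n).quotKerEquivOfSurjective (toOld_surj P Y n)).symm (toOld P Y n z)
      = Submodule.Quotient.mk z := by
    rw [LinearEquiv.symm_apply_eq]; rfl
  simp only [cmp, LinearEquiv.trans_apply, this]
  rfl

lemma cmp_nat {X X' : ModuleCat.{0} R} (P : ProjectiveResolution X) (P' : ProjectiveResolution X')
    (Y : ModuleCat.{0} R) (n : ℕ) (g : X' ⟶ X)
    (α : ((_root_.Ext R (ModuleCat.{0} R) n).obj (op X)).obj Y) :
    cmp P' Y n ((((_root_.Ext R (ModuleCat.{0} R) n).map g.op).app Y) α) =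
      (Ext.mk₀ g).comp (cmp P Y n α) (zero_add n) := by
  obtain ⟨z, rfl⟩ := toOld_surj P Y n α
  let φ : ProjectiveResolution.Hom P' P g :=
    ⟨ProjectiveResolution.lift g P' P, by
      have := congrArg (fun h => h.f 0) (ProjectiveResolution.lift_commutes g P' P)
      exact this⟩
  have h1 := ProjectiveResolution.isoLeftDerivedObj_hom_naturality g P' P φ.hom
    (by have := φ.hom_f_zero_comp_π_f_zero; exact this)
    ((linearYoneda R (ModuleCat.{0} R)).obj Y).rightOp n
  let ψ : KK P' Y ⟶ KK P Y :=
    (((linearYoneda R (ModuleCat.{0} R)).obj Y).rightOp.mapHomologicalComplex _).map φ.hom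
  have h2 : ((_root_.Ext R (ModuleCat.{0} R) n).map g.op).app Y (toOld P Y n z)
      = toOld P' Y n ((HomologicalComplex.opcyclesMap ψ n).unop z) := by
    have h3 := congrArg (fun h => (h ≫ (KK P Y).homologyι n).unop z) h1
    have h4 := HomologicalComplex.homologyι_naturality ψ n
    refine Eq.trans h3 ?_
    have h5 := congrArg (fun h => ((ProjectiveResolution.isoLeftDerivedObj P' ((linearYoneda R (ModuleCat.{0} R)).obj Y).rightOp n).hom ≫ h).unop z) h4
    exact h5
  rw [h2, cmp_toOld, cmp_toOld, toNew_apply, toNew_apply]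
  rw [ProjectiveResolution.mk₀_comp_extMk _ _ _ _ φ]
  congr 1
  have h6 := congrArg (fun h => h.unop z) (HomologicalComplex.p_opcyclesMap ψ n)
  exact h6
end Cmp

section LC
open Abelian
variable {R : Type} [CommRing R] (a : Ideal R)

/-- the module R/a^k -/
abbrev Q (k : ℕ) : ModuleCat.{0} R := ModuleCat.of R (R ⧸ a ^ k)

/-- transition map -/
def fac {k l : ℕ} (h : k ≤ l) : Q a l ⟶ Q a k :=
  ModuleCat.ofHom <| Submodule.mapQ _ _ LinearMap.id (Ideal.pow_le_pow_right h)

lemma fac_self (k : ℕ) : fac a (le_refl k) = 𝟙 _ := by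
  ext x; rfl

lemma fac_comp {k l m : ℕ} (h : k ≤ l) (h' : l ≤ m) : fac a h' ≫ fac a h = fac a (h.trans h') := by
  ext x; rfl

/-- Ext of R/a^k -/
abbrev EE (n : ℕ) (M : ModuleCat.{0} R) (k : ℕ) : Type := Abelian.Ext (Q a k) M n

/-- precomposition as a linear map -/
noncomputable def pre {X X' : ModuleCat.{0} R} (g : X' ⟶ X) (M : ModuleCat.{0} R) (n : ℕ) :
    Abelian.Ext X M n →ₗ[R] Abelian.Ext X' M n where
  toFun α := (Ext.mk₀ g).comp α (zero_add n)
  map_add' := by simp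
  map_smul' := by simp

lemma pre_apply {X X' : ModuleCat.{0} R} (g : X' ⟶ X) (M : ModuleCat.{0} R) (n : ℕ)
    (α : Abelian.Ext X M n) : pre g M n α = (Ext.mk₀ g).comp α (zero_add n) := rfl

lemma pre_pre {X X' X'' : ModuleCat.{0} R} (g : X' ⟶ X) (g' : X'' ⟶ X')
    (M : ModuleCat.{0} R) (n : ℕ)
    (α : Abelian.Ext X M n) : pre g' M n (pre g M n α) = pre (g' ≫ g) M n α := by
  simp [pre_apply]

/-- postcomposition as a linear map -/
noncomputable def post (X : ModuleCat.{0} R) {M N : ModuleCat.{0} R} {d : ℕ} (β : Abelian.Ext M N d)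
    (n m : ℕ) (h : n + d = m) :
    Abelian.Ext X M n →ₗ[R] Abelian.Ext X N m where
  toFun α := α.comp β h
  map_add' := by simp
  map_smul' := by simp

lemma post_apply (X : ModuleCat.{0} R) {M N : ModuleCat.{0} R} {d : ℕ} (β : Abelian.Ext M N d)
    (n m : ℕ) (h : n + d = m) (α) : post X β n m h α = α.comp β h := rfl

lemma post_pre {X X' : ModuleCat.{0} R} (g : X' ⟶ X) {M N : ModuleCat.{0} R} {d : ℕ}
    (β : Abelian.Ext M N d) (n m : ℕ) (h : n + d = m) (α) :
    post X' β n m h (pre g M n α) = pre g N m (post X β n m h α) := by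
  simp only [pre_apply, post_apply]
  rw [Ext.comp_assoc]
  omega

instance dirSys (n : ℕ) (M : ModuleCat.{0} R) :
    DirectedSystem (EE a n M) (fun k l h => pre (fac a h) M n) where
  map_self k x := by rw [fac_self]; simp [pre_apply]
  map_map k l m h h' x := by rw [pre_pre, fac_comp]

/-- local cohomology as a direct limit -/
abbrev LC (n : ℕ) (M : ModuleCat.{0} R) : Type :=
  Module.DirectLimit (EE a n M) (fun _ _ h => pre (fac a h) M n)

/-- structure map -/
noncomputable abbrev inc (n : ℕ) (M : ModuleCat.{0} R) (k : ℕ) : EE a n M k →ₗ[R] LC a n M :=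
  Module.DirectLimit.of R ℕ (EE a n M) (fun _ _ h => pre (fac a h) M n) k

lemma inc_pre (n : ℕ) (M : ModuleCat.{0} R) {k l : ℕ} (h : k ≤ l) (α : EE a n M k) :
    inc a n M l (pre (fac a h) M n α) = inc a n M k α :=
  Module.DirectLimit.of_f

lemma inc_surj (n : ℕ) (M : ModuleCat.{0} R) (z : LC a n M) : ∃ k α, inc a n M k α = z :=
  Module.DirectLimit.exists_of z

lemma inc_zero (n : ℕ) (M : ModuleCat.{0} R) {k : ℕ} (α : EE a n M k) (h : inc a n M k α = 0) :
    ∃ (l : ℕ) (h : k ≤ l), pre (fac a h) M n α = 0 :=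
  Module.DirectLimit.of.zero_exact h

/-- map induced by an Ext class -/
noncomputable def LCpost {M N : ModuleCat.{0} R} {d : ℕ} (β : Abelian.Ext M N d)
    (n m : ℕ) (h : n + d = m) : LC a n M →ₗ[R] LC a m N :=
  Module.DirectLimit.map (fun k => post (Q a k) β n m h) (by
    intro i j hij
    ext x
    exact post_pre _ _ _ _ _ _)

lemma LCpost_inc {M N : ModuleCat.{0} R} {d : ℕ} (β : Abelian.Ext M N d)
    (n m : ℕ) (h : n + d = m) (k : ℕ) (α : EE a n M k) :
    LCpost a β n m h (inc a n M k α) = inc a m N k (α.comp β h) :=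
  Module.DirectLimit.map_apply_of _ _ _

lemma LCpost_comp {M N L : ModuleCat.{0} R} {d e f : ℕ} (β : Abelian.Ext M N d)
    (γ : Abelian.Ext N L e) (n m l : ℕ) (h : n + d = m) (h' : m + e = l)
    (hf : d + e = f) (z : LC a n M) :
    LCpost a γ m l h' (LCpost a β n m h z) = LCpost a (β.comp γ hf) n l (by omega) z := by
  obtain ⟨k, α, rfl⟩ := inc_surj a n M z
  simp only [LCpost_inc]
  rw [Ext.comp_assoc]
  omega

lemma LCpost_zero {M N : ModuleCat.{0} R} {d : ℕ}
    (n m : ℕ) (h : n + d = m) (z : LC a n M) :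
    LCpost a (0 : Abelian.Ext M N d) n m h z = 0 := by
  obtain ⟨k, α, rfl⟩ := inc_surj a n M z
  simp [LCpost_inc]

lemma LCpost_smul {M : ModuleCat.{0} R} (r : R) (n : ℕ) (z : LC a n M) :
    LCpost a (Ext.mk₀ (r • 𝟙 M)) n n (add_zero n) z = r • z := by
  obtain ⟨k, α, rfl⟩ := inc_surj a n M z
  rw [LCpost_inc, ← Ext.smul_eq_comp_mk₀, map_smul]

variable {a}

lemma exact₂ {S : ShortComplex (ModuleCat.{0} R)} (hS : S.ShortExact) (n : ℕ)
    (z : LC a n S.X₂) (hz : LCpost a (Ext.mk₀ S.g) n n (add_zero n) z = 0) :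
    ∃ y : LC a n S.X₁, LCpost a (Ext.mk₀ S.f) n n (add_zero n) y = z := by
  obtain ⟨k, α, rfl⟩ := inc_surj a n _ z
  rw [LCpost_inc] at hz
  obtain ⟨l, h, hl⟩ := inc_zero a n _ _ hz
  have := post_pre (fac a h) (Ext.mk₀ S.g) n n (add_zero n) α
  rw [post_apply, post_apply, hl] at this
  obtain ⟨x, hx⟩ := Ext.covariant_sequence_exact₂ _ hS _ this
  refine ⟨inc a n _ l x, ?_⟩
  rw [LCpost_inc, hx, inc_pre]

lemma exact₃ {S : ShortComplex (ModuleCat.{0} R)} (hS : S.ShortExact) (n : ℕ)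
    (z : LC a n S.X₃) (hz : LCpost a hS.extClass n (n+1) rfl z = 0) :
    ∃ y : LC a n S.X₂, LCpost a (Ext.mk₀ S.g) n n (add_zero n) y = z := by
  obtain ⟨k, α, rfl⟩ := inc_surj a n _ z
  rw [LCpost_inc] at hz
  obtain ⟨l, h, hl⟩ := inc_zero a (n+1) _ _ hz
  have := post_pre (fac a h) hS.extClass n (n+1) rfl α
  rw [post_apply, post_apply, hl] at this
  obtain ⟨x, hx⟩ := Ext.covariant_sequence_exact₃ _ hS _ _ this
  refine ⟨inc a n _ l x, ?_⟩
  rw [LCpost_inc, hx, inc_pre]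

lemma exact₁ {S : ShortComplex (ModuleCat.{0} R)} (hS : S.ShortExact) (n : ℕ)
    (z : LC a (n+1) S.X₁) (hz : LCpost a (Ext.mk₀ S.f) (n+1) (n+1) (add_zero _) z = 0) :
    ∃ y : LC a n S.X₃, LCpost a hS.extClass n (n+1) rfl y = z := by
  obtain ⟨k, α, rfl⟩ := inc_surj a (n+1) _ z
  rw [LCpost_inc] at hz
  obtain ⟨l, h, hl⟩ := inc_zero a (n+1) _ _ hz
  have := post_pre (fac a h) (Ext.mk₀ S.f) (n+1) (n+1) rfl α
  rw [post_apply, post_apply, hl] at this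
  obtain ⟨x, hx⟩ := Ext.covariant_sequence_exact₁ _ hS _ this rfl
  refine ⟨inc a n _ l x, ?_⟩
  rw [LCpost_inc, hx, inc_pre]

lemma comp_g_δ {S : ShortComplex (ModuleCat.{0} R)} (hS : S.ShortExact) (n : ℕ)
    (z : LC a n S.X₂) : 
    LCpost a hS.extClass n (n+1) rfl (LCpost a (Ext.mk₀ S.g) n n (add_zero n) z) = 0 := by
  rw [LCpost_comp _ _ _ _ _ _ _ _ (zero_add 1), hS.comp_extClass, LCpost_zero]

lemma comp_δ_f {S : ShortComplex (ModuleCat.{0} R)} (hS : S.ShortExact) (n : ℕ)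
    (z : LC a n S.X₃) : 
    LCpost a (Ext.mk₀ S.f) (n+1) (n+1) (add_zero _) (LCpost a hS.extClass n (n+1) rfl z) = 0 := by
  rw [LCpost_comp _ _ _ _ _ _ _ _ (add_zero 1), hS.extClass_comp, LCpost_zero]

/-- every element is killed by a power -/
lemma torsion (n : ℕ) (M : ModuleCat.{0} R) (z : LC a n M) :
    ∃ k : ℕ, ∀ r ∈ a ^ k, r • z = 0 := by
  obtain ⟨k, α, rfl⟩ := inc_surj a n _ z
  refine ⟨k, fun r hr => ?_⟩
  rw [← map_smul]
  have h0 : r • 𝟙 (Q a k) = 0 := by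
    ext
    change r • (1 : R ⧸ a ^ k) = 0
    rw [← map_one (Ideal.Quotient.mk (a^k)), ← Ideal.Quotient.mk_eq_mk,
      ← Submodule.Quotient.mk_smul, Submodule.Quotient.mk_eq_zero]
    simpa using hr
  have : r • α = (Ext.mk₀ (r • 𝟙 (Q a k))).comp α (zero_add n) := by
    rw [Ext.mk₀_smul]; simp
  rw [this, h0]; simp

/-- H^0 is f.g. -/
lemma finite_zero [IsNoetherianRing R] (M : ModuleCat.{0} R) [Module.Finite R M] :
    Module.Finite R (LC a 0 M) := by
  let q : ∀ k, ModuleCat.of R R ⟶ Q a k := fun k => ModuleCat.ofHom (Submodule.mkQ (a ^ k))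
  have hq : ∀ k l (h : k ≤ l), q l ≫ fac a h = q k := fun k l h => by ext; rfl
  let f : LC a 0 M →ₗ[R] Abelian.Ext (ModuleCat.of R R) M 0 :=
    Module.DirectLimit.lift R ℕ _ _ (fun k => pre (q k) M 0) (by
      intro k l h x
      rw [pre_pre, hq])
  have hf : Function.Injective f := by
    apply Module.DirectLimit.lift_injective
    intro k
    have : Epi (q k) := by
      rw [ModuleCat.epi_iff_surjective]
      exact Submodule.mkQ_surjective _
    exact Ext.precomp_mk₀_injective_of_epi M (q k)
  exact Module.Finite.of_injective f hf

end LC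

section Vanish
open Abelian
variable {R : Type} [CommRing R] {a : Ideal R}

lemma step {F L : Type} [AddCommGroup F] [AddCommGroup L]
    [Module R F] [Module R L] [Module.Projective R F]
    (f : F →ₗ[R] L) (hf : Function.Surjective f)
    (T : ModuleCat.{0} R) (n : ℕ)
    (ih : ∀ η : Abelian.Ext (ModuleCat.of R (LinearMap.ker f)) T n, ∃ j : ℕ,
      pre (ModuleCat.ofHom (a ^ j • ⊤ : Submodule R (LinearMap.ker f)).subtype) T n η = 0)
    (ξ : Abelian.Ext (ModuleCat.of R L) T (n+1)) :
    ∃ j : ℕ, ∀ {F' L' : Type} [AddCommGroup F'] [AddCommGroup L'] [Module R F'] [Module R L']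
      (f' : F' →ₗ[R] L') (_ : Function.Surjective f')
      (u : F' →ₗ[R] F) (v : L' →ₗ[R] L) (_ : ∀ x, f (u x) = v (f' x)),
      (∀ y ∈ LinearMap.ker f', u y ∈ a ^ j • LinearMap.ker f) → 
      pre (ModuleCat.ofHom v) T (n+1) ξ = 0 := by
  have hS := LinearMap.shortExact_shortComplexKer hf
  have : Projective (f.shortComplexKer).X₂ :=
    ModuleCat.projective_of_categoryTheory_projective (ModuleCat.of R F)
  obtain ⟨η, hη⟩ := Ext.contravariant_sequence_exact₃ hS T ξ (Ext.eq_zero_of_projective _)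
    (add_comm 1 n)
  obtain ⟨j, hj⟩ := ih η
  refine ⟨j, fun {F' L'} _ _ _ _ f' hf' u v huv h => ?_⟩
  have hS' := LinearMap.shortExact_shortComplexKer hf'
  have h2 : ∀ y : LinearMap.ker f', ∃ h : u y ∈ LinearMap.ker f, 
      (⟨u y, h⟩ : LinearMap.ker f) ∈ (a ^ j • ⊤ : Submodule R (LinearMap.ker f)) := by
    intro y
    have := h y y.2
    have h3 : a ^ j • LinearMap.ker f = (a ^ j • ⊤ : Submodule R (LinearMap.ker f)).map
        (LinearMap.ker f).subtype := by
      rw [Submodule.map_smul'', Submodule.map_top, Submodule.range_subtype]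
    rw [h3] at this
    obtain ⟨w, hw, hw'⟩ := this
    have : u y ∈ LinearMap.ker f := by rw [← hw']; exact w.2
    refine ⟨this, ?_⟩
    have e : (⟨u y, this⟩ : LinearMap.ker f) = w := Subtype.ext hw'.symm
    rw [e]; exact hw
  let w : LinearMap.ker f' →ₗ[R] (a ^ j • ⊤ : Submodule R (LinearMap.ker f)) :=
    LinearMap.codRestrict _ (LinearMap.codRestrict _ (u ∘ₗ (LinearMap.ker f').subtype)
      (fun y => (h2 y).1)) (fun y => (h2 y).2)
  let φ : f'.shortComplexKer ⟶ f.shortComplexKer :=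
    { τ₁ := ModuleCat.ofHom w ≫
        ModuleCat.ofHom (a ^ j • ⊤ : Submodule R (LinearMap.ker f)).subtype
      τ₂ := ModuleCat.ofHom u
      τ₃ := ModuleCat.ofHom v
      comm₁₂ := by ext; rfl
      comm₂₃ := by ext x; exact huv x }
  have h4 := ShortComplex.ShortExact.extClass_naturality hS' hS φ
  rw [← hη]
  change (Ext.mk₀ φ.τ₃).comp (hS.extClass.comp η (add_comm 1 n)) (zero_add (n+1)) = 0
  rw [← Ext.comp_assoc _ _ _ (zero_add 1) _ (by omega), ← h4,
    Ext.comp_assoc _ _ _ _ (zero_add n) (by omega)]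
  have : (Ext.mk₀ φ.τ₁).comp η (zero_add n) = 0 := by
    have := pre_pre (ModuleCat.ofHom (a ^ j • ⊤ : Submodule R (LinearMap.ker f)).subtype)
      (ModuleCat.ofHom w) T n η
    rw [hj, map_zero] at this
    exact this.symm
  rw [this, Ext.comp_zero]

lemma ext_restrict [IsNoetherianRing R] (T : ModuleCat.{0} R) (k : ℕ)
    (hT : ∀ r ∈ a ^ k, ∀ x : T, r • x = 0) (n : ℕ) :
    ∀ (L : Type) [AddCommGroup L] [Module R L] [Module.Finite R L]
      (η : Abelian.Ext (ModuleCat.of R L) T n), ∃ j : ℕ,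
      pre (ModuleCat.ofHom (a ^ j • ⊤ : Submodule R L).subtype) T n η = 0 := by
  induction n with
  | zero =>
    intro L _ _ _ η
    refine ⟨k, ?_⟩
    obtain ⟨g, rfl⟩ := Ext.addEquiv₀.symm.surjective η
    change (Ext.mk₀ _).comp (Ext.mk₀ g) (zero_add 0) = 0
    rw [Ext.mk₀_comp_mk₀]
    have : (ModuleCat.ofHom (a ^ k • ⊤ : Submodule R L).subtype) ≫ g = 0 := by
      ext ⟨x, hx⟩
      change g x = 0
      induction hx using Submodule.smul_induction_on' with
      | smul r hr m hm => 
        have : g (r • m) = r • g m := map_smul g.hom r m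
        rw [this, hT r hr]
      | add x hx y hy h1 h2 => rw [map_add, h1, h2, add_zero]
    rw [this, Ext.mk₀_zero]
  | succ n ih =>
    intro L _ _ _ ξ
    obtain ⟨F, _, _, _, _, f, surjf⟩ := Module.exists_finite_presentation R L
    obtain ⟨c, hc⟩ := Ideal.exists_pow_inf_eq_pow_smul a (LinearMap.ker f)
    obtain ⟨j, hj⟩ := step (a := a) f surjf T n (fun η => ih _ η) ξ
    refine ⟨j + c, ?_⟩
    have hmap : (a ^ (j + c) • ⊤ : Submodule R F).map f = (a ^ (j + c) • ⊤ : Submodule R L) := by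
      rw [Submodule.map_smul'', Submodule.map_top, LinearMap.range_eq_top.2 surjf]
    have hres : ∀ x ∈ (a ^ (j + c) • ⊤ : Submodule R F), f x ∈ (a ^ (j + c) • ⊤ : Submodule R L) := by
      intro x hx; rw [← hmap]; exact ⟨x, hx, rfl⟩
    refine hj (f.restrict hres) ?_ (Submodule.subtype _) _ (fun _ => rfl) ?_
    · rintro ⟨y, hy⟩
      have hy' := hy
      rw [← hmap] at hy'
      obtain ⟨x, hx, hxy⟩ := hy'
      exact ⟨⟨x, hx⟩, Subtype.ext hxy⟩
    · rintro ⟨y, hy⟩ hk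
      have h1 : y ∈ LinearMap.ker f := congrArg Subtype.val hk
      have h2 : y ∈ a ^ (j + c) • ⊤ ⊓ LinearMap.ker f := ⟨hy, h1⟩
      rw [hc _ (by omega), Nat.add_sub_cancel] at h2
      exact Submodule.smul_mono le_rfl inf_le_right h2

lemma vanish [IsNoetherianRing R] (T : ModuleCat.{0} R) (k : ℕ)
    (hT : ∀ r ∈ a ^ k, ∀ x : T, r • x = 0) (n : ℕ) (z : LC a (n+1) T) : z = 0 := by
  obtain ⟨l, ξ, rfl⟩ := inc_surj a (n+1) _ z
  obtain ⟨j, hj⟩ := step (a := a) (Submodule.mkQ (a ^ l)) (Submodule.mkQ_surjective _) T n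
    (fun η => ext_restrict T k hT n _ η) ξ
  have := hj (Submodule.mkQ (a ^ (l + j))) (Submodule.mkQ_surjective _) LinearMap.id
    (Submodule.mapQ _ _ LinearMap.id (Ideal.pow_le_pow_right (Nat.le_add_right l j)))
    (fun _ => rfl) (by
      intro y hy
      rw [Submodule.ker_mkQ] at hy ⊢
      rw [smul_eq_mul, ← pow_add, add_comm]
      exact hy)
  rw [← inc_pre a (n+1) T (Nat.le_add_right l j)]
  change inc a (n+1) T (l+j) (pre (ModuleCat.ofHom _) T (n+1) ξ) = 0
  rw [this, map_zero]

end Vanish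

section Compare
open Abelian
variable {R : Type} [CommRing R] (a : Ideal R)

lemma gen (n : ℕ) (M : ModuleCat.{0} R) (F : ℕᵒᵖᵒᵖ ⥤ ModuleCat.{0} R) (c : Cocone F)
    (hc : IsColimit c) (e : ∀ k : ℕ, F.obj (op (op k)) ≃ₗ[R] EE a n M k)
    (he : ∀ (k l : ℕ) (h : k ≤ l) (f : op (op k) ⟶ op (op l)) (x : F.obj (op (op k))),
      e l (F.map f x) = pre (fac a h) M n (e k x)) :
    Nonempty (c.pt ≃ₗ[R] LC a n M) := by
  let φ : LC a n M →ₗ[R] c.pt := Module.DirectLimit.lift R ℕ _ _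
    (fun k => (c.ι.app (op (op k))).hom ∘ₗ (e k).symm.toLinearMap) (by
      intro k l h x
      obtain ⟨y, rfl⟩ := (e k).surjective x
      let f : op (op k) ⟶ op (op l) := (homOfLE h).op.op
      rw [← he k l h f]
      simp only [LinearMap.comp_apply, LinearEquiv.coe_coe, LinearEquiv.symm_apply_apply]
      have := c.w f
      exact congrArg (fun g => g.hom y) this)
  have hφ : ∀ k x, φ (inc a n M k (e k x)) = c.ι.app (op (op k)) x := by
    intro k x
    simp [φ, Module.DirectLimit.lift_of]
  refine ⟨(LinearEquiv.ofBijective φ ⟨?_, ?_⟩).symm⟩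
  · rw [injective_iff_map_eq_zero]
    intro z hz
    obtain ⟨k, α, rfl⟩ := inc_surj a n M z
    obtain ⟨y, rfl⟩ := (e k).surjective α
    rw [hφ] at hz
    have hz' : c.ι.app (op (op k)) y = c.ι.app (op (op k)) 0 := by rw [hz, map_zero]
    obtain ⟨j, f, g, hfg⟩ := (Concrete.isColimit_rep_eq_iff_exists F hc _ _).1 hz'
    obtain ⟨⟨l⟩⟩ := j
    have h : k ≤ l := leOfHom f.unop.unop
    rw [map_zero] at hfg
    rw [← inc_pre a n M h, ← he k l h f, hfg, map_zero, map_zero]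
  · intro x
    obtain ⟨⟨⟨k⟩⟩, y, rfl⟩ := Concrete.isColimit_exists_rep F hc x
    exact ⟨_, hφ k y⟩

lemma compare (n : ℕ) (M : ModuleCat.{0} R) :
    Nonempty (((localCohomology a n).obj M) ≃ₗ[R] LC a n M) := by
  have := localCohomology.hasColimitDiagram.{0,0} (localCohomology.idealPowersDiagram a) n
  let D := localCohomology.diagram (localCohomology.idealPowersDiagram a) n
  have hc : IsColimit (((evaluation _ _).obj M).mapCocone (colimit.cocone D)) :=
    isColimitOfPreserves _ (colimit.isColimit D)
  refine gen a n M _ _ hc (fun k => cmp (projectiveResolution (Q a k)) M n) ?_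
  intro k l h f x
  exact cmp_nat (projectiveResolution (Q a k)) (projectiveResolution (Q a l)) M n (fac a h) x

end Compare

section Main
open Abelian
variable {R : Type} [CommRing R] [IsNoetherianRing R] {a : Ideal R}

lemma fg_comap {A B : Type} [AddCommGroup A] [AddCommGroup B] [Module R A] [Module R B]
    (f : A →ₗ[R] B) (hk : (LinearMap.ker f).FG) (N : Submodule R B) (hN : N.FG) :
    (N.comap f).FG := by
  apply Submodule.fg_of_fg_map_of_fg_inf_ker f
  · exact hN.of_le (Submodule.map_comap_le f N)
  · rw [inf_eq_right.2 (fun x hx => by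
      rw [Submodule.mem_comap, LinearMap.mem_ker.1 hx]; exact N.zero_mem)]
    exact hk

lemma finite_mid {A B C : Type} [AddCommGroup A] [AddCommGroup B] [AddCommGroup C]
    [Module R A] [Module R B] [Module R C] [Module.Finite R A] [Module.Finite R C]
    (f : A →ₗ[R] B) (g : B →ₗ[R] C) (h : ∀ b, g b = 0 → ∃ x, f x = b) : Module.Finite R B := by
  refine ⟨?_⟩
  apply Submodule.fg_of_fg_map_of_fg_inf_ker g
  · exact IsNoetherian.noetherian _
  · have h1 : (LinearMap.range f).FG := Module.Finite.iff_fg.1 inferInstance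
    refine h1.of_le ?_
    rintro b ⟨-, hb⟩
    exact h b hb

lemma exists_reg (M : Type) [AddCommGroup M] [Module R M] [Module.Finite R M]
    (h : ∀ m : M, (∀ r ∈ a, r • m = 0) → m = 0) : ∃ y ∈ a, IsSMulRegular M y := by
  by_contra! hcon
  have hsub : (a : Set R) ⊆ ⋃ p ∈ associatedPrimes R M, (p : Set R) := by
    rw [biUnion_associatedPrimes_eq_zero_divisors]
    intro y hy
    have := hcon y hy
    rw [isSMulRegular_iff_right_eq_zero_of_smul] at this
    push Not at this
    obtain ⟨x, hx, hx'⟩ := this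
    exact ⟨x, hx', hx⟩
  obtain ⟨p, hp, hap⟩ := (a.subset_union_prime_finite (associatedPrimes.finite R M)
    (f := id) 0 0 fun _ h _ _ ↦ h.isPrime).1 hsub
  obtain ⟨hp1, x, hx⟩ := isAssociatedPrime_iff.1 hp
  have : x = 0 := by
    apply h
    intro r hr
    have := hap hr
    rw [id, hx] at this
    simpa using this
  apply hp1.ne_top
  rw [hx, this]
  simp

/-- the inductive statement -/
def PP (a : Ideal R) (t : ℕ) : Prop := ∀ (M : ModuleCat.{0} R) [Module.Finite R M],
  (∀ i < t, Module.Finite R (LC a i M)) → ∀ N : Submodule R (LC a t M), N.FG →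
    (associatedPrimes R (LC a t M ⧸ N)).Finite

lemma PP_zero : PP a 0 := by
  intro M _ _ N _
  have := finite_zero (a := a) M
  exact associatedPrimes.finite R _

lemma kill_fg (n : ℕ) (M : ModuleCat.{0} R) (N : Submodule R (LC a n M)) (hN : N.FG)
    (y : R) (hy : y ∈ a) : ∃ k : ℕ, ∀ z ∈ N, y ^ k • z = 0 := by
  obtain ⟨s, rfl⟩ := hN
  choose k hk using fun z => torsion (a := a) n M z
  refine ⟨s.sup k, fun z hz => ?_⟩
  induction hz using Submodule.span_induction with
  | mem z hz => exact hk z _ (Ideal.pow_le_pow_right (Finset.le_sup hz) (Ideal.pow_mem_pow hy _))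
  | zero => simp
  | add x y _ _ h1 h2 => rw [smul_add, h1, h2, add_zero]
  | smul r x _ h => rw [smul_comm, h, smul_zero]

lemma reg_case (t : ℕ) (ih : PP a t) (M : ModuleCat.{0} R) [Module.Finite R M]
    (hM : ∀ i < t + 1, Module.Finite R (LC a i M)) (N : Submodule R (LC a (t+1) M)) (hN : N.FG)
    (y : R) (hy : y ∈ a) (hreg : IsSMulRegular M y) :
    (associatedPrimes R (LC a (t+1) M ⧸ N)).Finite := by
  obtain ⟨k, hk⟩ := kill_fg _ _ N hN y hy
  have hS := (hreg.pow (k+1)).smulShortComplex_shortExact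
  have : Module.Finite R (M.smulShortComplex (y^(k+1))).X₂ := inferInstanceAs (Module.Finite R M)
  have hfin3 : Module.Finite R (M.smulShortComplex (y^(k+1))).X₃ := by
    have : Epi (M.smulShortComplex (y^(k+1))).g := hS.epi_g
    exact Module.Finite.of_surjective _ ((ModuleCat.epi_iff_surjective _).1 this)
  have hM' : ∀ i < t, Module.Finite R (LC a i (M.smulShortComplex (y^(k+1))).X₃) := by
    intro i hi
    have h1 : Module.Finite R (LC a i (M.smulShortComplex (y^(k+1))).X₂) := hM i (by omega)
    have h2 : Module.Finite R (LC a (i+1) (M.smulShortComplex (y^(k+1))).X₁) := hM (i+1) (by omega)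
    exact finite_mid (LCpost a (Ext.mk₀ _) i i (add_zero i)) (LCpost a hS.extClass i (i+1) rfl)
      (exact₃ hS i)
  let δ : LC a t (M.smulShortComplex (y^(k+1))).X₃ →ₗ[R] LC a (t+1) M :=
    LCpost a hS.extClass t (t+1) rfl
  have hker : (LinearMap.ker δ).FG := by
    have h1 : Module.Finite R (LC a t (M.smulShortComplex (y^(k+1))).X₂) := hM t (by omega)
    let p : LC a t (M.smulShortComplex (y^(k+1))).X₂ →ₗ[R] LC a t (M.smulShortComplex (y^(k+1))).X₃ :=
      LCpost a (Ext.mk₀ (M.smulShortComplex (y^(k+1))).g) t t (add_zero t)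
    have h2 : (LinearMap.range p).FG := Module.Finite.iff_fg.1 inferInstance
    refine h2.of_le ?_
    intro z hz
    exact exact₃ hS t z hz
  have hN' := fg_comap δ hker N hN
  refine (ih _ hM' _ hN').subset ?_
  intro p hp
  obtain ⟨hp1, x, hx⟩ := isAssociatedPrime_iff.1 hp
  obtain ⟨h, rfl⟩ := Submodule.mkQ_surjective N x
  have hmem : ∀ r, r ∈ p ↔ r • h ∈ N := by
    intro r
    rw [hx, Submodule.mem_colon_singleton, Submodule.mem_bot, ← map_smul, Submodule.mkQ_apply,
      Submodule.Quotient.mk_eq_zero]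
  have hyp : y ∈ p := by
    obtain ⟨l, hl⟩ := torsion (a := a) (t+1) M h
    apply hp1.mem_of_pow_mem l
    rw [hmem, hl _ (Ideal.pow_mem_pow hy l)]
    exact N.zero_mem
  have hxh : y ^ (k+1) • h = 0 := by
    rw [pow_succ, mul_smul]
    exact hk _ ((hmem y).1 hyp)
  obtain ⟨d, hd⟩ := exact₁ (a := a) hS t h 
    ((LCpost_smul a (M := M) (y^(k+1)) (t+1) h).trans hxh)
  rw [AssociatedPrimes.mem_iff, isAssociatedPrime_iff]
  refine ⟨hp1, Submodule.mkQ _ d, ?_⟩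
  ext r
  rw [hmem, Submodule.mem_colon_singleton, Submodule.mem_bot, ← map_smul, Submodule.mkQ_apply,
      Submodule.Quotient.mk_eq_zero, Submodule.mem_comap, map_smul]
  change _ ↔ r • (LCpost a hS.extClass t (t+1) rfl d) ∈ N
  rw [hd]
  rfl

lemma PP_succ (t : ℕ) (ih : PP a t) : PP a (t+1) := by
  intro M _ hM N hN
  let G : ℕ →o Submodule R M :=
    ⟨fun k => Submodule.torsionBySet R M (a ^ k : Ideal R), fun k l h =>
      Submodule.torsionBySet_le_torsionBySet_of_subset (Ideal.pow_le_pow_right h)⟩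
  obtain ⟨k, hk⟩ := monotone_stabilizes_iff_noetherian.2 (inferInstance : IsNoetherian R M) G
  have hG : ∀ (l : ℕ) (m : M), m ∈ G l ↔ ∀ r ∈ a ^ l, r • m = 0 := by
    intro l m
    change m ∈ Submodule.torsionBySet R M _ ↔ _
    rw [Submodule.mem_torsionBySet_iff]
    exact ⟨fun h r hr => h ⟨r, hr⟩, fun h r => h r r.2⟩
  let M' : ModuleCat.{0} R := ModuleCat.of R (M ⧸ G k)
  obtain ⟨y, hy, hreg⟩ := exists_reg (a := a) (M ⧸ G k) (by
    intro m hm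
    obtain ⟨m, rfl⟩ := Submodule.mkQ_surjective _ m
    rw [Submodule.mkQ_apply, Submodule.Quotient.mk_eq_zero, hk (k+1) (by omega), hG]
    intro r hr
    rw [pow_succ] at hr
    induction hr using Submodule.mul_induction_on' with
    | mem_mul_mem r hr s hs =>
      have := hm s hs
      rw [← map_smul, Submodule.mkQ_apply, Submodule.Quotient.mk_eq_zero, hG] at this
      rw [mul_smul]
      exact this r hr
    | add r _ s _ h1 h2 => rw [add_smul, h1, h2, add_zero])
  have hS := LinearMap.shortExact_shortComplexKer (Submodule.mkQ_surjective (G k))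
  have hv : ∀ n (z : LC a (n+1) (Submodule.mkQ (G k)).shortComplexKer.X₁), z = 0 := by
    intro n z
    refine vanish _ k ?_ n z
    rintro r hr ⟨x, hx⟩
    rw [Submodule.ker_mkQ, hG] at hx
    exact Subtype.ext (hx r hr)
  let π : ∀ n, LC a (n+1) M →ₗ[R] LC a (n+1) M' := fun n =>
    LCpost a (Ext.mk₀ (Submodule.mkQ (G k)).shortComplexKer.g) (n+1) (n+1) (add_zero _)
  have hπ : ∀ n, Function.Bijective (π n) := by
    intro n
    refine ⟨?_, fun z => exact₃ hS (n+1) z (hv _ _)⟩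
    rw [injective_iff_map_eq_zero]
    intro z hz
    obtain ⟨w, hw⟩ := exact₂ hS (n+1) z hz
    rw [← hw, hv _ w, map_zero]
  let e := LinearEquiv.ofBijective (π t) (hπ t)
  have := reg_case t ih M' (by
    intro i hi
    cases i with
    | zero => exact finite_zero M'
    | succ i =>
      have := hM (i+1) hi
      exact Module.Finite.of_surjective (π i) (hπ i).2) (N.map e.toLinearMap) (hN.map _) y hy hreg
  rw [LinearEquiv.AssociatedPrimes.eq (Submodule.Quotient.equiv N (N.map e.toLinearMap) e rfl)]
  exact this

lemma PP_all (t : ℕ) : PP a t := by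
  induction t with
  | zero => exact PP_zero
  | succ t ih => exact PP_succ t ih

lemma final (M : ModuleCat.{0} R) [Module.Finite R M] (t : ℕ)
    (hfg : ∀ i < t, Module.Finite R ((localCohomology a i).obj M)) :
    (associatedPrimes R ((localCohomology a t).obj M)).Finite := by
  have h1 := PP_all (a := a) t M (by
    intro i hi
    have := hfg i hi
    exact Module.Finite.equiv (compare a i M).some) ⊥ Submodule.fg_bot
  rw [LinearEquiv.AssociatedPrimes.eq ((compare a t M).some.trans
    (Submodule.quotEquivOfEqBot ⊥ rfl).symm)]
  exact h1

end Main

end LCAux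

open CategoryTheory

/-- **Corollary 4.4, second part.** If the local cohomology modules `H^i_𝔞(M)` are finitely
generated for all `i < t`, then `Ass H^t_𝔞(M)` is a finite set. -/
theorem associatedPrimes_localCohomology_finite
    {R : Type} [CommRing R] [IsNoetherianRing R] (𝔞 : Ideal R)
    (M : Type) [AddCommGroup M] [Module R M] [Module.Finite R M]
    (t : ℕ) (ht : 0 < t)
    (hfg : ∀ i < t, Module.Finite R ((localCohomology 𝔞 i).obj (ModuleCat.of R M))) :
    (associatedPrimes R ((localCohomology 𝔞 t).obj (ModuleCat.of R M))).Finite := by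
  exact LCAux.final (a := 𝔞) (ModuleCat.of R M) t hfg
end
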